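/- arXiv:1310.4257 — 6 statements merged into one kernel-verified Lean document; each statement's English description precedes it below -/
import Mathlib

section
/- Let χ be a primitive Dirichlet character of odd conductor f. Then for every integer j ≥ 0, −2·(1 − χ(2)·2^{1+j})·L(−j, χ) = E_{j,χ}; that is, the analytic continuation of the Euler L-function L_E(s,χ) = 2∑_{n=1}^∞ (−1)^n χ(n) n^{−s} satisfies L_E(−j, χ) = E_{j,χ}. -/
open Finset

/-- The Euler polynomials `E_n(x)`, defined (over `ℚ`) by the recurrence
`E_n(x) = x^n - (1/2) ∑_{k<n} (n choose k) E_k(x)` equivalent to the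
generating function `2e^{xt}/(e^t + 1) = ∑_{n=0}^∞ E_n(x) t^n/n!`. -/
noncomputable def eulerPoly : ℕ → Polynomial ℚ
  | n => Polynomial.X ^ n -
      Polynomial.C (1 / 2 : ℚ) * ∑ k : Fin n, (n.choose k : ℚ) • eulerPoly k
  decreasing_by exact k.isLt

theorem Polynomial.eval_add_one_of_derivative_eq {p : ℕ → Polynomial ℚ}
    (hp : ∀ n, derivative (p n) = n * p (n - 1)) (n : ℕ) (x : ℚ) :
    (p n).eval (x + 1) = ∑ k ∈ range (n + 1), (n.choose k : ℚ) * (p k).eval x := by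
  have hiter (k : ℕ) : derivative^[k] (p n) = (n.descFactorial k : Polynomial ℚ) * p (n - k) := by
    induction k with
    | zero => simp
    | succ k ih =>
      rw [Function.iterate_succ_apply', ih, derivative_mul, hp, Nat.descFactorial_succ,
        derivative_natCast, Nat.sub_sub]
      push_cast
      ring
  have hhasse (k : ℕ) : (hasseDeriv k (p n)).eval x = (n.choose k : ℚ) * (p (n - k)).eval x := by
    have h := congrArg (eval x) ((congrFun (factorial_smul_hasseDeriv k) (p n)).trans (hiter k))
    have hk : (k.factorial : ℚ) ≠ 0 := by exact_mod_cast k.factorial_ne_zero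
    rw [Nat.descFactorial_eq_factorial_mul_choose] at h
    simp [mul_assoc, hk] at h
    exact h
  have hdeg : (taylor x (p n)).natDegree < n + 1 := by
    rw [Nat.lt_succ_iff, natDegree_le_iff_coeff_eq_zero]
    intro N hN
    rw [taylor_coeff, hhasse, Nat.choose_eq_zero_of_lt hN]
    simp
  rw [add_comm x 1, ← taylor_eval, eval_eq_sum_range' hdeg, ← sum_range_reflect]
  refine sum_congr rfl fun k hk => ?_
  have hk' : k ≤ n := by simpa [Nat.lt_succ_iff] using hk
  rw [taylor_coeff, hhasse, one_pow, mul_one, Nat.add_sub_cancel, Nat.choose_symm hk',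
    Nat.sub_sub_self hk']

theorem bernoulli_eval_duplication (n : ℕ) (x : ℚ) :
    (2 : ℚ) ^ n * ((Polynomial.bernoulli n).eval (x / 2) +
      (Polynomial.bernoulli n).eval (x / 2 + 1 / 2)) = 2 * (Polynomial.bernoulli n).eval x := by
  open Polynomial in
  let F (n : ℕ) : Polynomial ℚ := C ((2 : ℚ) ^ n / 2) *
    ((Polynomial.bernoulli n).comp (C (1 / 2) * X) +
      (Polynomial.bernoulli n).comp (C (1 / 2) * X + C (1 / 2)))
  have hFe (n : ℕ) (x : ℚ) : (F n).eval x = (2 : ℚ) ^ n / 2 *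
      ((Polynomial.bernoulli n).eval (x / 2) +
      (Polynomial.bernoulli n).eval (x / 2 + 1 / 2)) := by
    simp [F, div_eq_inv_mul]
  have hFd (n : ℕ) : derivative (F n) = n * F (n - 1) := by
    refine Polynomial.funext fun x => ?_
    rcases n with _ | n
    · simp [F]
    · simp only [F, derivative_mul, derivative_add, derivative_comp, derivative_bernoulli]
      simp
      ring
  have hFs (n : ℕ) (x : ℚ) : ∑ k ∈ range (n + 1), ((n + 1).choose k : ℚ) * (F k).eval x =
      (n + 1) * x ^ n := by
    have h := eval_add_one_of_derivative_eq hFd (n + 1) x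
    rw [sum_range_succ] at h
    have hb := bernoulli_eval_one_add (n + 1) (x / 2)
    rw [hFe (n + 1), hFe (n + 1), show (x + 1) / 2 + 1 / 2 = 1 + x / 2 by ring, hb,
      show (x + 1) / 2 = x / 2 + 1 / 2 by ring] at h
    simp only [Nat.choose_self, Nat.cast_one, one_mul, Nat.add_sub_cancel, Nat.cast_add,
      div_pow] at h
    have h2 : (2 : ℚ) ^ n ≠ 0 := by positivity
    field_simp at h
    refine mul_left_cancel₀ h2 ?_
    linear_combination (-1 / 2) * h
  have hF (n : ℕ) : (F n).eval x = (Polynomial.bernoulli n).eval x := by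
    induction n using Nat.strong_induction_on with
    | _ n ih =>
      have h1 := hFs n x
      have h2 := congrArg (eval x) (sum_bernoulli n)
      simp only [eval_finsetSum, eval_smul, smul_eq_mul, eval_monomial] at h2
      rw [← h2, sum_range_succ, sum_range_succ,
        sum_congr rfl fun k hk => by rw [ih k (mem_range.mp hk)]] at h1
      have hn : ((n + 1).choose n : ℚ) ≠ 0 := by
        rw [Nat.choose_succ_self_right]; positivity
      exact mul_left_cancel₀ hn (add_left_cancel h1)
  rw [← hF n, hFe]
  ring

theorem eulerPoly_eval_eq_bernoulli (n : ℕ) (x : ℚ) :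
    (n + 1) * (eulerPoly n).eval x = (2 : ℚ) ^ (n + 1) *
      ((Polynomial.bernoulli (n + 1)).eval (x / 2 + 1 / 2) -
        (Polynomial.bernoulli (n + 1)).eval (x / 2)) := by
  open Polynomial in
  let P (n : ℕ) : Polynomial ℚ := C ((2 : ℚ) ^ (n + 1) / (n + 1)) *
    ((Polynomial.bernoulli (n + 1)).comp (C (1 / 2) * X + C (1 / 2)) -
      (Polynomial.bernoulli (n + 1)).comp (C (1 / 2) * X))
  have hPe (n : ℕ) (x : ℚ) : (P n).eval x = (2 : ℚ) ^ (n + 1) / (n + 1) *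
      ((Polynomial.bernoulli (n + 1)).eval (x / 2 + 1 / 2) -
      (Polynomial.bernoulli (n + 1)).eval (x / 2)) := by
    simp [P, div_eq_inv_mul]
  have hPd (n : ℕ) : derivative (P n) = n * P (n - 1) := by
    refine Polynomial.funext fun x => ?_
    rcases n with _ | n
    · simp [P]
    · simp only [P, derivative_mul, derivative_sub, derivative_add, derivative_comp,
        derivative_bernoulli]
      simp
      have : (n : ℚ) + 1 ≠ 0 := by positivity
      have : (n : ℚ) + 1 + 1 ≠ 0 := by positivity
      field_simp
      ring
  have hPs (n : ℕ) (x : ℚ) :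
      ∑ k ∈ range n, (n.choose k : ℚ) * (P k).eval x + 2 * (P n).eval x = 2 * x ^ n := by
    have h := eval_add_one_of_derivative_eq hPd n x
    rw [sum_range_succ] at h
    have hb := bernoulli_eval_one_add (n + 1) (x / 2)
    rw [hPe n, show (x + 1) / 2 + 1 / 2 = 1 + x / 2 by ring, hb,
      show (x + 1) / 2 = x / 2 + 1 / 2 by ring] at h
    have hn : (n : ℚ) + 1 ≠ 0 := by positivity
    have h2 : (2 : ℚ) ^ n ≠ 0 := by positivity
    rw [hPe n]
    rw [hPe n] at h
    simp only [Nat.choose_self, Nat.cast_one, one_mul, Nat.add_sub_cancel, Nat.cast_add,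
      div_pow] at h
    field_simp at h ⊢
    refine mul_left_cancel₀ h2 ?_
    linear_combination -h
  have hP (n : ℕ) : (eulerPoly n).eval x = (P n).eval x := by
    induction n using Nat.strong_induction_on with
    | _ n ih =>
      have h1 := hPs n x
      rw [eulerPoly, ← Fin.sum_univ_eq_sum_range] at *
      simp only [eval_sub, eval_mul, eval_pow, eval_X, eval_C, eval_finsetSum, eval_smul,
        smul_eq_mul]
      rw [Fintype.sum_congr _ _ fun k : Fin n => by rw [ih k k.isLt]]
      linear_combination (-1 / 2) * h1
  have hn : (n : ℚ) + 1 ≠ 0 := by positivity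
  rw [hP n, hPe]
  field_simp

open Complex Filter Topology in
theorem norm_one_div_add_cpow_sub_le {x : ℝ} (hx : 0 < x) (hx1 : x ≤ 1) {s : ℂ} (hs : 0 < s.re)
    (n : ℕ) :
    ‖1 / ((n : ℂ) + (x : ℂ)) ^ s - 1 / ((n : ℂ) + 1) ^ s‖ ≤
      ‖s‖ * (1 / ((n : ℝ) + x) ^ (s.re + 1)) := by
  have hpos (u : ℝ) (hu : u ∈ Set.Icc x 1) : 0 < (n : ℝ) + u := by
    have := hx.trans_le hu.1
    positivity
  have hd (u : ℝ) (hu : u ∈ Set.Icc x 1) :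
      HasDerivWithinAt (fun u : ℝ => ((n : ℂ) + (u : ℂ)) ^ (-s))
        (-s * ((n : ℂ) + (u : ℂ)) ^ (-s - 1)) (Set.Icc x 1) u := by
    have h1 : HasDerivAt (fun z : ℂ => (n : ℂ) + z) 1 (u : ℂ) := (hasDerivAt_id _).const_add _
    have h2 := h1.cpow_const (c := -s) (.inl (by simpa using hpos u hu))
    simpa using h2.comp_ofReal.hasDerivWithinAt
  have h := (convex_Icc x 1).norm_image_sub_le_of_norm_hasDerivWithin_le hd
    (C := ‖s‖ * (1 / ((n : ℝ) + x) ^ (s.re + 1))) (fun u hu => by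
      rw [norm_mul, norm_neg]
      gcongr
      rw [← ofReal_natCast, ← ofReal_add, norm_cpow_eq_rpow_re_of_pos (hpos u hu), one_div,
        ← Real.rpow_neg (by positivity)]
      simp only [sub_re, neg_re, one_re]
      rw [show -s.re - 1 = -(s.re + 1) by ring]
      exact Real.rpow_le_rpow_of_nonpos (by positivity) (by linarith [hu.1]) (by linarith))
    (Set.right_mem_Icc.2 hx1) (Set.left_mem_Icc.2 hx1)
  simp only [cpow_neg, ← one_div, ofReal_one] at h
  refine h.trans ?_
  rw [Real.norm_eq_abs, abs_sub_comm, abs_of_nonneg (by linarith)]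
  exact mul_le_of_le_one_right (by positivity) (by linarith)

theorem summable_one_div_nat_add_pos_rpow {x : ℝ} (hx : 0 < x) {s : ℝ} (hs : 1 < s) :
    Summable fun n : ℕ => 1 / ((n : ℝ) + x) ^ s := by
  have := (Real.summable_one_div_nat_add_rpow x s).2 hs
  refine this.congr fun n => ?_
  rw [abs_of_pos (by positivity)]

open Complex Filter Topology in
theorem hasSum_hurwitzZeta_sub_hurwitzZeta_zero {x : ℝ} (hx : 0 < x) (hx1 : x ≤ 1) {s : ℂ}
    (hs : 0 < s.re) :
    HasSum (fun n : ℕ => 1 / ((n : ℂ) + (x : ℂ)) ^ s - 1 / ((n : ℂ) + 1) ^ s)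
      (HurwitzZeta.hurwitzZeta (x : UnitAddCircle) s - HurwitzZeta.hurwitzZeta 0 s) := by
  have hsum {s : ℂ} (hs : 0 < s.re) :
      Summable fun n : ℕ => 1 / ((n : ℂ) + (x : ℂ)) ^ s - 1 / ((n : ℂ) + 1) ^ s :=
    .of_norm_bounded ((summable_one_div_nat_add_pos_rpow hx (by linarith)).mul_left _)
      (norm_one_div_add_cpow_sub_le hx hx1 hs)
  have hopen : IsOpen {s : ℂ | 0 < s.re} := isOpen_lt continuous_const continuous_re
  suffices Set.EqOn (fun s => HurwitzZeta.hurwitzZeta (x : UnitAddCircle) s -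
      HurwitzZeta.hurwitzZeta 0 s)
      (fun s => ∑' n : ℕ, (1 / ((n : ℂ) + (x : ℂ)) ^ s - 1 / ((n : ℂ) + 1) ^ s))
      {s : ℂ | 0 < s.re} by
    have h := this hs
    simp only at h
    exact h ▸ (hsum hs).hasSum
  refine AnalyticOnNhd.eqOn_of_preconnected_of_eventuallyEq (𝕜 := ℂ) (z₀ := 2)
    (DifferentiableOn.analyticOnNhd
      (HurwitzZeta.differentiable_hurwitzZeta_sub_hurwitzZeta _ _).differentiableOn hopen)
    (DifferentiableOn.analyticOnNhd (fun s hs => ?_) hopen)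
    (convex_halfSpace_re_gt 0).isPreconnected (by simp) ?_
  · simp only [Set.mem_ofPred_eq] at hs
    let U : Set ℂ := {z | s.re / 2 < z.re} ∩ Metric.ball 0 (‖s‖ + 1)
    have hU : IsOpen U := (isOpen_lt continuous_const continuous_re).inter Metric.isOpen_ball
    have hsU : s ∈ U := ⟨by simp only [Set.mem_ofPred_eq]; linarith, by simp⟩
    refine ((differentiableOn_tsum_of_summable_norm (U := U)
      (u := fun n : ℕ => (‖s‖ + 1) * (1 / ((n : ℝ) + x) ^ (s.re / 2 + 1) +
        1 / ((n : ℝ) + x) ^ (‖s‖ + 1 + 1))) ?_ ?_ hU ?_).differentiableAt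
      (hU.mem_nhds hsU)).differentiableWithinAt
    · exact ((summable_one_div_nat_add_pos_rpow hx (by linarith)).add
        (summable_one_div_nat_add_pos_rpow hx (by linarith [norm_nonneg s]))).mul_left _
    · intro n
      have h1 : (n : ℂ) + (x : ℂ) ≠ 0 := by
        rw [← ofReal_natCast, ← ofReal_add]; exact ofReal_ne_zero.2 (by positivity)
      have h2 : (n : ℂ) + 1 ≠ 0 := n.cast_add_one_ne_zero
      simp only [one_div, ← cpow_neg]
      refine DifferentiableOn.sub ?_ ?_
      · exact (differentiable_id.neg.const_cpow (.inl h1)).differentiableOn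
      · exact (differentiable_id.neg.const_cpow (.inl h2)).differentiableOn
    · rintro n w ⟨hw, hw'⟩
      simp only [Set.mem_ofPred_eq, Metric.mem_ball, dist_zero_right] at hw hw'
      refine (norm_one_div_add_cpow_sub_le hx hx1 (by linarith) n).trans ?_
      have hwre : w.re ≤ ‖s‖ + 1 := (re_le_norm w).trans hw'.le
      gcongr
      simp only [one_div, ← Real.rpow_neg (by positivity : 0 ≤ (n : ℝ) + x)]
      rcases le_total 1 ((n : ℝ) + x) with h | h
      · refine (Real.rpow_le_rpow_of_exponent_le h (by linarith)).trans
          (le_add_of_nonneg_right (by positivity))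
      · refine (Real.rpow_le_rpow_of_exponent_ge (by positivity) h (by linarith)).trans
          (le_add_of_nonneg_left (by positivity))
  · filter_upwards [(isOpen_lt continuous_const continuous_re).mem_nhds
      (show (1 : ℝ) < (2 : ℂ).re by simp)] with s hs
    have h1 := HurwitzZeta.hasSum_hurwitzZeta_of_one_lt_re ⟨hx.le, hx1⟩ hs
    have h2 := HurwitzZeta.hasSum_hurwitzZeta_of_one_lt_re (a := 1) (by simp) hs
    have h10 : ((1 : ℝ) : UnitAddCircle) = 0 := AddCircle.coe_period 1
    rw [h10, ofReal_one] at h2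
    exact ((h1.sub h2).tsum_eq).symm

theorem one_div_rpow_sub_bounds {a b t : ℝ} (ha : 0 < a) (hab : a ≤ b) (ht : 0 < t) :
    t * (b - a) * (1 / b ^ (t + 1)) ≤ 1 / a ^ t - 1 / b ^ t ∧
      1 / a ^ t - 1 / b ^ t ≤ t * (b - a) * (1 / a ^ (t + 1)) := by
  rcases hab.eq_or_lt with rfl | hlt
  · simp
  have hb := ha.trans hlt
  obtain ⟨c, ⟨hac, hcb⟩, hc⟩ := exists_hasDerivAt_eq_slope (fun u : ℝ => u ^ (-t))
    (fun u => -t * u ^ (-t - 1)) hlt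
    (continuousOn_id.rpow_const fun u hu => .inl (ha.trans_le hu.1).ne')
    (fun u hu => Real.hasDerivAt_rpow_const (.inl (ha.trans hu.1).ne'))
  have hc0 := ha.trans hac
  rw [eq_div_iff (sub_pos.2 hlt).ne'] at hc
  simp only [one_div, ← Real.rpow_neg ha.le, ← Real.rpow_neg hb.le]
  have h1 : b ^ (-(t + 1)) ≤ c ^ (-(t + 1)) :=
    Real.rpow_le_rpow_of_nonpos hc0 hcb.le (by linarith)
  have h2 : c ^ (-(t + 1)) ≤ a ^ (-(t + 1)) :=
    Real.rpow_le_rpow_of_nonpos ha hac.le (by linarith)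
  rw [show -t - 1 = -(t + 1) by ring] at hc
  have h0 : 0 ≤ t * (b - a) := by nlinarith
  constructor
  · nlinarith [mul_le_mul_of_nonneg_left h1 h0]
  · nlinarith [mul_le_mul_of_nonneg_left h2 h0]

open Complex Filter Topology in
theorem tendsto_mul_tsum_one_div_nat_add_rpow {x : ℝ} (hx : 0 < x) (hx1 : x ≤ 1) :
    Tendsto (fun t : ℝ => t * ∑' n : ℕ, 1 / ((n : ℝ) + x) ^ (t + 1)) (𝓝[>] 0) (𝓝 1) := by
  rw [← tendsto_ofReal_iff, ofReal_one]
  have hmap : Tendsto (fun t : ℝ => (t : ℂ) + 1) (𝓝[>] 0) (𝓝[≠] 1) := by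
    refine tendsto_nhdsWithin_iff.2 ⟨?_, ?_⟩
    · have : Continuous fun t : ℝ => (t : ℂ) + 1 := by fun_prop
      simpa using (this.tendsto 0).mono_left nhdsWithin_le_nhds
    · filter_upwards [self_mem_nhdsWithin] with t ht
      simpa using (ne_of_gt ht : t ≠ 0)
  refine ((HurwitzZeta.hurwitzZeta_residue_one (x : UnitAddCircle)).comp hmap).congr' ?_
  filter_upwards [self_mem_nhdsWithin] with t ht
  have ht : 0 < t := ht
  have h := HurwitzZeta.hasSum_hurwitzZeta_of_one_lt_re (a := x) ⟨hx.le, hx1⟩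
    (s := (t : ℂ) + 1) (by simpa using ht)
  simp only [Function.comp_apply, add_sub_cancel_right, ofReal_mul]
  rw [← h.tsum_eq, ofReal_tsum]
  congr 1
  refine tsum_congr fun n => ?_
  rw [ofReal_div, ofReal_cpow (by positivity)]
  simp

open Complex Filter Topology in
theorem hurwitzZeta_apply_zero {x : ℝ} (hx : 0 < x) (hx1 : x ≤ 1) :
    HurwitzZeta.hurwitzZeta (x : UnitAddCircle) 0 = 1 / 2 - x := by
  suffices HurwitzZeta.hurwitzZeta (x : UnitAddCircle) 0 - HurwitzZeta.hurwitzZeta 0 0 =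
      ((1 - x : ℝ) : ℂ) by
    rw [HurwitzZeta.hurwitzZeta_zero, riemannZeta_zero] at this
    push_cast at this
    linear_combination this
  have hcont : Tendsto (fun t : ℝ => HurwitzZeta.hurwitzZeta (x : UnitAddCircle) t -
      HurwitzZeta.hurwitzZeta 0 t) (𝓝[>] 0)
      (𝓝 (HurwitzZeta.hurwitzZeta (x : UnitAddCircle) 0 - HurwitzZeta.hurwitzZeta 0 0)) := by
    have := (HurwitzZeta.differentiable_hurwitzZeta_sub_hurwitzZeta
      (x : UnitAddCircle) 0).continuous.comp continuous_ofReal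
    simpa [Function.comp_def] using (this.tendsto 0).mono_left nhdsWithin_le_nhds
  refine tendsto_nhds_unique hcont ?_
  have hlim : Tendsto (fun t : ℝ => ∑' n : ℕ, (1 / ((n : ℝ) + x) ^ t - 1 / ((n : ℝ) + 1) ^ t))
      (𝓝[>] 0) (𝓝 (1 - x)) := by
    have hlow := (tendsto_mul_tsum_one_div_nat_add_rpow one_pos le_rfl).const_mul (1 - x)
    have hupp := (tendsto_mul_tsum_one_div_nat_add_rpow hx hx1).const_mul (1 - x)
    rw [mul_one] at hlow hupp
    have hb (t : ℝ) (ht : 0 < t) (n : ℕ) := one_div_rpow_sub_bounds (a := (n : ℝ) + x)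
      (b := n + 1) (by positivity) (by linarith) ht
    have hs (t : ℝ) (ht : 0 < t) :
        Summable fun n : ℕ => 1 / ((n : ℝ) + x) ^ t - 1 / ((n : ℝ) + 1) ^ t := by
      refine .of_nonneg_of_le (fun n => le_trans ?_ (hb t ht n).1) (fun n => (hb t ht n).2)
        (((summable_one_div_nat_add_pos_rpow hx
          (lt_add_of_pos_left 1 ht)).mul_left (t * (1 - x))).congr fun n => by ring)
      have : 0 ≤ (n : ℝ) + 1 - (n + x) := by linarith
      positivity
    refine tendsto_of_tendsto_of_tendsto_of_le_of_le' hlow hupp ?_ ?_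
    · filter_upwards [self_mem_nhdsWithin] with t ht
      rw [← tsum_mul_left, ← tsum_mul_left]
      refine Summable.tsum_le_tsum (fun n => le_trans (le_of_eq ?_) (hb t ht n).1)
        (((summable_one_div_nat_add_pos_rpow one_pos
          (lt_add_of_pos_left 1 ht)).mul_left _).mul_left _) (hs t ht)
      ring
    · filter_upwards [self_mem_nhdsWithin] with t ht
      rw [← tsum_mul_left, ← tsum_mul_left]
      refine Summable.tsum_le_tsum (fun n => (hb t ht n).2.trans (le_of_eq ?_)) (hs t ht)
        (((summable_one_div_nat_add_pos_rpow hx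
          (lt_add_of_pos_left 1 ht)).mul_left _).mul_left _)
      ring
  refine (tendsto_ofReal_iff.2 hlim).congr' ?_
  filter_upwards [self_mem_nhdsWithin] with t ht
  rw [← (hasSum_hurwitzZeta_sub_hurwitzZeta_zero hx hx1 (s := t) (by simpa using ht)).tsum_eq,
    ofReal_tsum]
  refine tsum_congr fun n => ?_
  rw [ofReal_sub, ofReal_div, ofReal_div, ofReal_cpow (by positivity),
    ofReal_cpow (by positivity)]
  simp

theorem hurwitzZeta_neg_nat_of_rat (k : ℕ) {q : ℚ} (hq : 0 < q) (hq1 : q ≤ 1) :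
    HurwitzZeta.hurwitzZeta ((q : ℝ) : UnitAddCircle) (-(k : ℂ)) =
      -1 / (k + 1) * (((Polynomial.bernoulli (k + 1)).eval q : ℚ) : ℂ) := by
  have h0 : (0 : ℝ) < q := by exact_mod_cast hq
  have h1 : (q : ℝ) ≤ 1 := by exact_mod_cast hq1
  rcases eq_or_ne k 0 with rfl | hk
  · simp [hurwitzZeta_apply_zero h0 h1]
  · rw [HurwitzZeta.hurwitzZeta_neg_nat hk ⟨h0.le, h1⟩, Complex.ofReal_ratCast,
      ← eq_ratCast (algebraMap ℚ ℂ) q, Polynomial.eval_map_apply, eq_ratCast]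

theorem ZMod.sum_eq_sum_Icc {M : Type*} [AddCommMonoid M] (N : ℕ) [NeZero N] (g : ZMod N → M) :
    ∑ z, g z = ∑ a ∈ Icc 1 N, g (a : ZMod N) := by
  symm
  refine sum_nbij (fun a => (a : ZMod N)) (by simp) ?_ ?_ fun _ _ => rfl
  · intro a ha b hb hab
    simp only [coe_Icc, Set.mem_Icc] at ha hb
    have h := (ZMod.natCast_eq_natCast_iff a b N).1 hab
    rcases le_total a b with hle | hle
    · have := Nat.eq_zero_of_dvd_of_lt ((Nat.modEq_iff_dvd' hle).1 h) (by lia)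
      lia
    · have := Nat.eq_zero_of_dvd_of_lt ((Nat.modEq_iff_dvd' hle).1 h.symm) (by lia)
      lia
  · intro z _
    rcases eq_or_ne z 0 with rfl | hz
    · exact ⟨N, by simp [NeZero.one_le], by simp⟩
    · exact ⟨z.val, by simp [Nat.one_le_iff_ne_zero, hz, (ZMod.val_lt z).le], by simp⟩

theorem DirichletCharacter.LFunction_neg_nat {N : ℕ} [NeZero N] (χ : DirichletCharacter ℂ N)
    (k : ℕ) :
    χ.LFunction (-(k : ℂ)) = -(N : ℂ) ^ k / (k + 1) * ∑ a ∈ Icc 1 N, χ (a : ZMod N) *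
      (((Polynomial.bernoulli (k + 1)).eval (a / N : ℚ) : ℚ) : ℂ) := by
  have hN : (0 : ℚ) < N := by exact_mod_cast NeZero.pos N
  rw [LFunction, ZMod.LFunction, neg_neg, Complex.cpow_natCast, ZMod.sum_eq_sum_Icc, mul_sum,
    mul_sum]
  refine sum_congr rfl fun a ha => ?_
  obtain ⟨ha1, haN⟩ := mem_Icc.1 ha
  have ha0 : (0 : ℚ) < a := by exact_mod_cast ha1
  have h := hurwitzZeta_neg_nat_of_rat k (q := a / N) (by positivity)
    ((div_le_one hN).2 (by exact_mod_cast haN))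
  push_cast at h
  rw [ZMod.toAddCircle_natCast, h]
  ring

theorem sum_range_one_add_neg_one_pow_mul (T : ℕ → ℂ) (m : ℕ) :
    ∑ i ∈ range (m + m), (1 + (-1) ^ (i + 1)) * T (i + 1) =
      2 * ∑ i ∈ range m, T (2 * (i + 1)) := by
  induction m with
  | zero => simp
  | succ m ih =>
    rw [show m + 1 + (m + 1) = m + m + 1 + 1 by ring, sum_range_succ, sum_range_succ, ih,
      sum_range_succ, show m + m + 1 + 1 = 2 * (m + 1) by ring,
      show m + m + 1 = 2 * m + 1 by ring]
    simp [pow_succ, pow_mul]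
    ring

theorem sum_Icc_one_eq_sum_range (g : ℕ → ℂ) (m : ℕ) :
    ∑ a ∈ Icc 1 m, g a = ∑ i ∈ range m, g (i + 1) := by
  rw [← Ico_add_one_right_eq_Icc, sum_Ico_eq_sum_range]
  simp [add_comm]

/-- The relation between alternating and ordinary character sums of a function satisfying the
duplication formula. -/
theorem DirichletCharacter.sum_neg_one_pow_mul_of_duplication {f : ℕ} (hf : _root_.Odd f)
    (χ : DirichletCharacter ℂ f) {B : ℚ → ℂ} {c : ℂ}
    (hB : ∀ x, c * (B (x / 2) + B (x / 2 + 1 / 2)) = 2 * B x) :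
    c * ∑ a ∈ Icc 1 f, (-1) ^ a * χ (a : ZMod f) *
      (B ((a / f : ℚ) / 2 + 1 / 2) - B ((a / f : ℚ) / 2)) =
      2 * (1 - χ 2 * c) * ∑ a ∈ Icc 1 f, χ (a : ZMod f) * B (a / f) := by
  have hf0 : (f : ℚ) ≠ 0 := by exact_mod_cast hf.pos.ne'
  let T (b : ℕ) : ℂ := χ (b : ZMod f) * B ((b / f : ℚ) / 2)
  have hshift (a : ℕ) : T (f + a) = χ (a : ZMod f) * B ((a / f : ℚ) / 2 + 1 / 2) := by
    have : ((f + a : ℕ) / f : ℚ) / 2 = (a / f : ℚ) / 2 + 1 / 2 := by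
      push_cast
      field_simp
      ring
    simp only [T, this]
    simp
  have hdouble (a : ℕ) : T (2 * a) = χ 2 * (χ (a : ZMod f) * B (a / f)) := by
    have : ((2 * a : ℕ) / f : ℚ) / 2 = a / f := by
      push_cast
      field_simp
    simp only [T, this]
    simp [mul_assoc]
  have h := sum_range_one_add_neg_one_pow_mul T f
  simp only [sum_range_add, add_assoc f, hdouble, hshift, ← mul_sum, pow_add (-1 : ℂ) f,
    hf.neg_one_pow] at h
  have hS : c * (∑ i ∈ range f, T (i + 1) + ∑ i ∈ range f,
      χ ((i + 1 : ℕ) : ZMod f) * B (((i + 1 : ℕ) / f : ℚ) / 2 + 1 / 2)) =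
      2 * ∑ i ∈ range f, χ ((i + 1 : ℕ) : ZMod f) * B ((i + 1 : ℕ) / f) := by
    rw [← sum_add_distrib, mul_sum, mul_sum]
    refine sum_congr rfl fun i _ => ?_
    linear_combination χ ((i + 1 : ℕ) : ZMod f) * hB ((i + 1 : ℕ) / f)
  simp only [sum_Icc_one_eq_sum_range, mul_sub, sum_sub_distrib]
  simp only [add_mul, one_mul, neg_mul, sum_add_distrib, sum_neg_distrib, mul_assoc] at h hS ⊢
  simp only [T] at h hS
  linear_combination hS - c * h

/-- Let `χ` be a primitive Dirichlet character of odd conductor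
`f`. For every integer `j ≥ 0`,
`−2·(1 − χ(2)·2^{1+j})·L(−j, χ) = E_{j,χ}`, where `L(·, χ)` is the analytic
continuation of the Dirichlet `L`-function of `χ` and
`E_{j,χ} = f^j ∑_{a=1}^f (−1)^a χ(a) E_j(a/f)` is the `j`-th generalized Euler
number. Equivalently, the analytic continuation of the Euler `L`-function
`L_E(s,χ) = 2 ∑_{n≥1} (−1)^n χ(n) n^{−s}` satisfies `L_E(−j,χ) = E_{j,χ}`. -/
theorem statement3 (f : ℕ) [NeZero f] (hf : Odd f) (χ : DirichletCharacter ℂ f)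
    (hχ : χ.IsPrimitive) (j : ℕ) :
    -2 * (1 - χ (2 : ZMod f) * (2 : ℂ) ^ (1 + j)) * DirichletCharacter.LFunction χ (-(j : ℂ)) =
      (f : ℂ) ^ j * ∑ a ∈ Finset.Icc 1 f, (-1 : ℂ) ^ a * χ ((a : ℕ) : ZMod f) *
        Polynomial.aeval ((a : ℂ) / (f : ℂ)) (eulerPoly j) := by
  have hj : (j : ℂ) + 1 ≠ 0 := j.cast_add_one_ne_zero
  have hE (a : ℕ) : Polynomial.aeval ((a : ℂ) / (f : ℂ)) (eulerPoly j) =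
      (2 : ℂ) ^ (j + 1) / (j + 1) *
        ((((Polynomial.bernoulli (j + 1)).eval ((a / f : ℚ) / 2 + 1 / 2) : ℚ) : ℂ) -
          (((Polynomial.bernoulli (j + 1)).eval ((a / f : ℚ) / 2) : ℚ) : ℂ)) := by
    have h := congrArg (Rat.cast : ℚ → ℂ) (eulerPoly_eval_eq_bernoulli j (a / f : ℚ))
    have ha : (a : ℂ) / f = algebraMap ℚ ℂ (a / f : ℚ) := by simp
    rw [ha, Polynomial.aeval_algebraMap_apply, Polynomial.coe_aeval_eq_eval, eq_ratCast]
    push_cast at h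
    rw [div_mul_eq_mul_div, eq_div_iff hj, ← h]
    ring
  have hB (x : ℚ) : (2 : ℂ) ^ (j + 1) *
      ((((Polynomial.bernoulli (j + 1)).eval (x / 2) : ℚ) : ℂ) +
        (((Polynomial.bernoulli (j + 1)).eval (x / 2 + 1 / 2) : ℚ) : ℂ)) =
      2 * (((Polynomial.bernoulli (j + 1)).eval x : ℚ) : ℂ) := by
    exact_mod_cast congrArg (Rat.cast : ℚ → ℂ) (bernoulli_eval_duplication (j + 1) x)
  have key := χ.sum_neg_one_pow_mul_of_duplication hf
    (B := fun x => (((Polynomial.bernoulli (j + 1)).eval x : ℚ) : ℂ)) hB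
  simp only [hE, mul_left_comm _ ((2 : ℂ) ^ (j + 1) / (j + 1)), ← mul_sum]
  rw [DirichletCharacter.LFunction_neg_nat, add_comm 1 j]
  linear_combination (-(f : ℂ) ^ j / (j + 1)) * key
end

section
/- Let χ be a primitive Dirichlet character of odd conductor f. Then for all real t with 0 < t < π/f, 2·∑_{n=1}^∞ (−1)^n χ(n) e^{−nt} = ∑_{j=0}^∞ ( f^j ∑_{a=1}^f (−1)^a χ(a) E_j(1 − a/f) ) · t^j/j!, where both series converge. -/
open Finset

namespace Complex

lemma exp_add_one_ne_zero_of_norm_lt_pi {s : ℂ} (hs : ‖s‖ < Real.pi) : exp s + 1 ≠ 0 := by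
  intro h
  have h1 : exp s = exp (Real.pi * I) := by
    rw [exp_pi_mul_I]
    exact eq_neg_of_add_eq_zero_left h
  obtain ⟨n, hn⟩ := exp_eq_exp_iff_exists_int.mp h1
  have h2 : s = ((2 * n + 1 : ℤ) : ℂ) * (Real.pi * I) := by
    rw [hn]
    push_cast
    ring
  have h3 : (1 : ℝ) ≤ |((2 * n + 1 : ℤ) : ℝ)| := by
    have : (1 : ℤ) ≤ |2 * n + 1| := Int.one_le_abs (by omega)
    exact_mod_cast this
  rw [h2, norm_mul, norm_mul, norm_I, mul_one, norm_intCast, norm_real, Real.norm_eq_abs,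
    abs_of_pos Real.pi_pos] at hs
  nlinarith [Real.pi_pos]

end Complex

lemma aeval_eulerPoly (x : ℂ) (n : ℕ) :
    Polynomial.aeval x (eulerPoly n) =
      x ^ n - 1 / 2 * ∑ k ∈ range n, (n.choose k : ℂ) * Polynomial.aeval x (eulerPoly k) := by
  rw [eulerPoly, Finset.sum_range (fun k => (n.choose k : ℂ) * Polynomial.aeval x (eulerPoly k))]
  simp [Algebra.smul_def]

/-- A function satisfying the functional equation of the generating function of the Euler
polynomials near `0` has their values as its derivatives at `0`. -/
lemma iteratedDeriv_eq_aeval_eulerPoly {x : ℂ} {g : ℂ → ℂ}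
    (hg : ∀ n : ℕ, ContDiffAt ℂ n g 0)
    (h : (fun s => Complex.exp s * g s + g s) =ᶠ[nhds 0] fun s => 2 * Complex.exp (x * s))
    (n : ℕ) : iteratedDeriv n g 0 = Polynomial.aeval x (eulerPoly n) := by
  induction n using Nat.strong_induction_on with
  | _ n ih =>
    have hexp : ContDiffAt ℂ n Complex.exp 0 := Complex.contDiff_exp.contDiffAt
    have h1 := h.iteratedDeriv_eq n
    have hderiv (m : ℕ) : iteratedDeriv m Complex.exp 0 = 1 := by
      simp [iteratedDeriv_eq_iterate]
    rw [iteratedDeriv_fun_add (hexp.mul (hg n)) (hg n)] at h1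
    simp_rw [mul_comm (Complex.exp _) (g _)] at h1
    rw [iteratedDeriv_fun_mul (hg n) hexp, iteratedDeriv_const_mul_field,
      iteratedDeriv_cexp_const_mul, Finset.sum_range_succ] at h1
    simp only [hderiv, mul_one, Nat.choose_self, Nat.cast_one, one_mul, mul_zero,
      Complex.exp_zero] at h1
    rw [Finset.sum_congr rfl fun k hk => by rw [ih k (mem_range.mp hk)]] at h1
    rw [aeval_eulerPoly]
    linear_combination h1 / 2

/-- The generating function of the Euler polynomials. -/
lemma hasSum_eulerPoly (x : ℂ) {s : ℂ} (hs : ‖s‖ < Real.pi) :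
    HasSum (fun j : ℕ => Polynomial.aeval x (eulerPoly j) * s ^ j / (j.factorial : ℂ))
      (2 * Complex.exp (x * s) / (Complex.exp s + 1)) := by
  set g : ℂ → ℂ := fun s => 2 * Complex.exp (x * s) / (Complex.exp s + 1) with hgdef
  have hne {z : ℂ} (hz : z ∈ Metric.ball (0 : ℂ) Real.pi) : Complex.exp z + 1 ≠ 0 :=
    Complex.exp_add_one_ne_zero_of_norm_lt_pi (by simpa using hz)
  have hdiff : DifferentiableOn ℂ g (Metric.ball 0 Real.pi) := fun z hz => by
    have h1 : DifferentiableAt ℂ (fun s => 2 * Complex.exp (x * s)) z := by fun_prop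
    have h2 : DifferentiableAt ℂ (fun s => Complex.exp s + 1) z := by fun_prop
    exact (h1.div h2 (hne hz)).differentiableWithinAt
  have hball : Metric.ball (0 : ℂ) Real.pi ∈ nhds 0 := Metric.ball_mem_nhds 0 Real.pi_pos
  have hcont (n : ℕ) : ContDiffAt ℂ n g 0 := (hdiff.analyticAt hball).contDiffAt
  have heq : (fun s => Complex.exp s * g s + g s) =ᶠ[nhds 0]
      fun s => 2 * Complex.exp (x * s) := by
    filter_upwards [hball] with z hz
    have := hne hz
    simp only [hgdef]
    field_simp
  have := Complex.hasSum_taylorSeries_on_ball hdiff (z := s) (by simpa using hs)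
  simp only [iteratedDeriv_eq_aeval_eulerPoly hcont heq, sub_zero, smul_eq_mul] at this
  refine this.congr_fun ?_
  intro j
  ring

lemma tsum_eq_sum_Icc_tsum {F : ℕ → ℂ} (hF : Summable fun k => F (k + 1)) {f : ℕ} (hf : f ≠ 0) :
    ∑' k, F (k + 1) = ∑ a ∈ Icc 1 f, ∑' m, F (a + f * m) := by
  obtain ⟨n, rfl⟩ := Nat.exists_eq_succ_of_ne_zero hf
  rw [Nat.sumByResidueClasses hF (n + 1)]
  trans ∑ j ∈ range (n + 1), ∑' m, F (j + (n + 1) * m + 1)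
  · exact Fin.sum_univ_eq_sum_range (fun j => ∑' m, F (j + (n + 1) * m + 1)) (n + 1)
  · refine Finset.sum_nbij' (· + 1) (· - 1) ?_ ?_ ?_ ?_ ?_
    · simp
    · simp only [mem_Icc, mem_range]; omega
    · simp
    · simp only [mem_Icc]; omega
    · intro j _
      congr! 3
      simp only [Nat.succ_eq_add_one]
      ring

/-- Let `χ` be a primitive Dirichlet character of odd conductor
`f`. For all real `t` with `0 < t < π/f`, both series below converge and
`2 ∑_{n=1}^∞ (−1)^n χ(n) e^{−nt}
  = ∑_{j=0}^∞ (f^j ∑_{a=1}^f (−1)^a χ(a) E_j(1 − a/f)) t^j/j!`.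
(The first series is indexed by `n = k + 1`, `k : ℕ`.) -/
theorem statement7 (f : ℕ) (hf : Odd f) (χ : DirichletCharacter ℂ f)
    (hχ : χ.IsPrimitive) (t : ℝ) (ht0 : 0 < t) (ht : t < Real.pi / f) :
    ∃ S : ℂ,
      HasSum (fun k : ℕ => 2 * (-1 : ℂ) ^ (k + 1) * χ ((k + 1 : ℕ) : ZMod f) *
        Complex.exp (-(((k + 1 : ℕ) : ℂ) * (t : ℂ)))) S ∧
      HasSum (fun j : ℕ =>
        ((f : ℂ) ^ j * ∑ a ∈ Finset.Icc 1 f, (-1 : ℂ) ^ a * χ ((a : ℕ) : ZMod f) *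
          Polynomial.aeval (1 - (a : ℂ) / (f : ℂ)) (eulerPoly j)) *
          (t : ℂ) ^ j / (j.factorial : ℂ)) S := by
  have hf0 : f ≠ 0 := hf.pos.ne'
  have hfC : (f : ℂ) ≠ 0 := Nat.cast_ne_zero.mpr hf0
  have : NeZero f := ⟨hf0⟩
  have hft : ‖((f : ℂ) * t)‖ < Real.pi := by
    rw [norm_mul, Complex.norm_natCast, Complex.norm_real, Real.norm_eq_abs, abs_of_pos ht0]
    rwa [lt_div_iff₀ (by exact_mod_cast hf.pos), mul_comm] at ht
  set F : ℕ → ℂ := fun n =>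
    2 * (-1 : ℂ) ^ n * χ (n : ZMod f) * Complex.exp (-((n : ℂ) * (t : ℂ))) with hF
  have hexp (n : ℕ) : Complex.exp (-((n : ℂ) * (t : ℂ))) = Complex.exp (-t) ^ n := by
    rw [← Complex.exp_nat_mul]
    ring_nf
  have hnorm : ‖Complex.exp (-t)‖ < 1 := by
    simpa [Complex.norm_exp] using ht0
  have hFsum : Summable F := by
    refine Summable.of_norm_bounded
      ((summable_geometric_of_lt_one (norm_nonneg _) hnorm).mul_left 2) fun n => ?_
    simp only [hF, hexp, norm_mul, norm_pow, norm_neg, norm_one, one_pow, mul_one, RCLike.norm_ofNat]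
    gcongr
    nlinarith [χ.norm_le_one (n : ZMod f)]
  have hFsum' : Summable fun k => F (k + 1) := (summable_nat_add_iff 1).mpr hFsum
  have hinner (a : ℕ) : ∑' m, F (a + f * m) =
      (-1 : ℂ) ^ a * χ (a : ZMod f) *
        (2 * Complex.exp ((1 - (a : ℂ) / f) * (f * t)) / (Complex.exp (f * t) + 1)) := by
    have hterm (m : ℕ) : F (a + f * m) = F a * (-Complex.exp (-(f * t))) ^ m := by
      simp only [hF, hexp, pow_add, pow_mul, hf.neg_one_pow, Nat.cast_add, Nat.cast_mul,
        CharP.cast_eq_zero, zero_mul, add_zero]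
      rw [neg_pow (Complex.exp (-(t : ℂ)) ^ f)]
      ring
    have hr : ‖-Complex.exp (-((f : ℂ) * t))‖ < 1 := by
      rw [norm_neg, hexp, norm_pow]
      exact pow_lt_one₀ (norm_nonneg _) hnorm hf0
    have hne := Complex.exp_add_one_ne_zero_of_norm_lt_pi hft
    have hsplit : Complex.exp ((1 - (a : ℂ) / f) * (f * t)) =
        Complex.exp (f * t) * Complex.exp (-(a * t)) := by
      rw [← Complex.exp_add]
      congr 1
      field_simp
      ring
    have hinv : (1 - -Complex.exp (-((f : ℂ) * t)))⁻¹ =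
        Complex.exp (f * t) / (Complex.exp (f * t) + 1) := by
      rw [Complex.exp_neg]
      have := Complex.exp_ne_zero ((f : ℂ) * t)
      field_simp
      rw [sub_neg_eq_add, div_self hne]
    simp_rw [hterm]
    rw [tsum_mul_left, tsum_geometric_of_norm_lt_one hr, hsplit, hinv]
    simp only [hF]
    ring
  refine ⟨∑' k, F (k + 1), hFsum'.hasSum, ?_⟩
  rw [tsum_eq_sum_Icc_tsum hFsum' hf0]
  simp_rw [hinner]
  have hsum := hasSum_sum fun (a : ℕ) (_ : a ∈ Icc 1 f) =>
    (hasSum_eulerPoly (1 - (a : ℂ) / f) hft).mul_left ((-1 : ℂ) ^ a * χ (a : ZMod f))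
  refine hsum.congr_fun fun j => ?_
  rw [mul_pow, Finset.mul_sum, Finset.sum_mul, Finset.sum_div]
  refine Finset.sum_congr rfl fun a _ => ?_
  ring
end

section
/- Let χ be a primitive Dirichlet character of odd conductor f. Then for all real t with 0 < t < π/f, 2·∑_{n=1}^∞ (−1)^n χ(n) e^{−nt} = ∑_{j=0}^∞ L_E(−j, χ) · (−t)^j/j!, where L_E(−j, χ) := −2(1 − χ(2)·2^{1+j})·L(−j, χ) and both series converge. -/
open Filter Topology Asymptotics

/-- If the Dirichlet series `∑ a k (k + 1)⁻ˢ` continues to `F`, and the exponential series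
`∑ a k e ^ (-(k + 1) t)` is `O(t)` as `t → 0+`, then `F 0 = 0`. -/
lemma eq_zero_of_hasSum_dirichlet_of_isBigO {a : ℕ → ℂ} {h : ℝ → ℂ} {F : ℂ → ℂ} {p σ : ℝ}
    (hp : 1 ≤ p) (hσ : 0 ≤ σ) (hF : ∀ s : ℂ, s ≠ p → DifferentiableAt ℂ F s)
    (hFs : ∀ s : ℂ, σ < s.re → HasSum (fun k : ℕ => a k / ((k : ℂ) + 1) ^ s) (F s))
    (hc : ContinuousOn h (Set.Ioi 0))
    (hsum : ∀ t : ℝ, 0 < t →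
      HasSum (fun k : ℕ => a k * Complex.exp (-(((k : ℂ) + 1) * t))) (h t))
    (h0 : h =O[𝓝[>] 0] fun t : ℝ => t) : F 0 = 0 := by
  have hnorm (t : ℝ) (k : ℕ) : ‖a k * Complex.exp (-(((k : ℂ) + 1) * t))‖ =
      ‖a k‖ * Real.exp (-(((k : ℝ) + 1) * t)) := by
    rw [norm_mul, Complex.norm_exp]; simp
  have htop : h =O[atTop] fun t => Real.exp (-1 * t) := by
    have hs1 : Summable fun k : ℕ => ‖a k‖ * Real.exp (-(((k : ℝ) + 1) * 1)) := by
      simpa only [hnorm] using (hsum 1 one_pos).summable.norm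
    refine IsBigO.of_bound
      (∑' k : ℕ, ‖a k‖ * Real.exp (-(((k : ℝ) + 1) * 1)) * Real.exp 1) ?_
    filter_upwards [eventually_ge_atTop 1] with t ht
    rw [← (hsum t (by linarith)).tsum_eq, Real.norm_eq_abs, Real.abs_exp, ← tsum_mul_right]
    refine tsum_of_norm_bounded ((hs1.mul_right _).mul_right _).hasSum fun k => ?_
    rw [hnorm, mul_assoc, mul_assoc, ← Real.exp_add, ← Real.exp_add]
    gcongr
    nlinarith [(Nat.cast_nonneg k : (0 : ℝ) ≤ k)]
  have hM (s : ℂ) (hs : -1 < s.re) : DifferentiableAt ℂ (mellin h) s := by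
    refine mellin_differentiableAt_of_isBigO_rpow_exp one_pos
      (hc.locallyIntegrableOn measurableSet_Ioi) htop (b := -1) ?_ hs
    simpa using h0
  have hEq (s : ℂ) (hs : σ < s.re) : F s = mellin h s * (Complex.Gamma s)⁻¹ := by
    have hs0 : 0 < s.re := hσ.trans_lt hs
    have key := hasSum_mellin (a := a) (p := fun k : ℕ => (k : ℝ) + 1) (F := h) (s := s)
      (fun k => Or.inr (by positivity)) hs0 (fun t ht => by
        convert hsum t ht using 3
        push_cast
        rw [neg_mul]) (by
        convert (hFs s hs).summable.norm using 2 with k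
        rw [norm_div]
        congr 1
        have := Complex.norm_cpow_eq_rpow_re_of_pos (x := (k : ℝ) + 1) (by positivity) s
        push_cast at this
        exact this.symm)
    have key2 := (hFs s hs).mul_left (Complex.Gamma s)
    have : mellin h s = Complex.Gamma s * F s := by
      refine key.unique (key2.congr_fun fun k => ?_)
      push_cast
      rw [mul_div_assoc]
    rw [this, mul_right_comm, mul_inv_cancel₀ (Complex.Gamma_ne_zero_of_re_pos hs0), one_mul]
  let U : Set ℂ := {s | -1 < s.re} ∩ ({s | s.re < 1 / 2} ∪ {s | 0 < s.im})
  have hUo : IsOpen U := by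
    refine (isOpen_lt continuous_const Complex.continuous_re).inter
      ((isOpen_lt Complex.continuous_re continuous_const).union
        (isOpen_lt continuous_const Complex.continuous_im))
  have hUc : IsPreconnected U := by
    have : U = ({s : ℂ | -1 < s.re} ∩ {s | s.re < 1 / 2}) ∪ ({s | -1 < s.re} ∩ {s | 0 < s.im}) :=
      Set.inter_union_distrib_left _ _ _
    rw [this]
    refine IsPreconnected.union Complex.I ?_ ?_ ?_ ?_
    · simp
    · simp
    · exact ((convex_halfSpace_re_gt _).inter (convex_halfSpace_re_lt _)).isPreconnected
    · exact ((convex_halfSpace_re_gt _).inter (convex_halfSpace_im_gt _)).isPreconnected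
  have hFU : AnalyticOnNhd ℂ F U := by
    refine DifferentiableOn.analyticOnNhd (fun s hs => (hF s ?_).differentiableWithinAt) hUo
    rintro rfl
    rcases hs.2 with h | h
    · simp only [Set.mem_ofPred_eq, Complex.ofReal_re] at h
      linarith
    · simp at h
  have hMU : AnalyticOnNhd ℂ (fun s => mellin h s * (Complex.Gamma s)⁻¹) U :=
    DifferentiableOn.analyticOnNhd (fun s hs =>
      ((hM s hs.1).mul (Complex.differentiable_one_div_Gamma s)).differentiableWithinAt) hUo
  have hz : (σ + 1 + Complex.I : ℂ) ∈ U :=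
    ⟨by simp only [Set.mem_ofPred_eq]; simp; linarith, Or.inr (by simp)⟩
  have := hFU.eqOn_of_preconnected_of_eventuallyEq hMU hUc hz (by
    have : {s : ℂ | σ < s.re} ∈ 𝓝 (σ + 1 + Complex.I : ℂ) :=
      (isOpen_lt continuous_const Complex.continuous_re).mem_nhds (by simp)
    filter_upwards [this] with s hs using hEq s hs)
  simpa using this (show (0 : ℂ) ∈ U from ⟨by simp, Or.inl (by simp)⟩)

/-- If the Dirichlet series `∑ a k (k + 1)⁻ˢ` continues to `F`, and the exponential series
`∑ a k e ^ (-(k + 1) t)` extends to a function `h` differentiable at `0`, then `F 0 = h 0`. -/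
lemma eq_of_hasSum_dirichlet_of_differentiableAt {a : ℕ → ℂ} {h : ℝ → ℂ} {F : ℂ → ℂ} {p σ : ℝ}
    (hp : 1 ≤ p) (hσ : 0 ≤ σ) (hF : ∀ s : ℂ, s ≠ p → DifferentiableAt ℂ F s)
    (hFs : ∀ s : ℂ, σ < s.re → HasSum (fun k : ℕ => a k / ((k : ℂ) + 1) ^ s) (F s))
    (hc : ContinuousOn h (Set.Ioi 0))
    (hsum : ∀ t : ℝ, 0 < t →
      HasSum (fun k : ℕ => a k * Complex.exp (-(((k : ℂ) + 1) * t))) (h t))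
    (h0 : DifferentiableAt ℝ h 0) : F 0 = h 0 := by
  have hd : DifferentiableAt ℝ (fun t : ℝ => h t - h 0 * Complex.exp (-(t : ℂ))) 0 := by
    refine h0.sub (DifferentiableAt.const_mul ?_ _)
    exact (Complex.ofRealCLM.differentiableAt.neg).cexp
  have hpi (c : ℂ) : HasSum (fun k : ℕ => (Pi.single 0 c : ℕ → ℂ) k) c := hasSum_pi_single 0 c
  have := eq_zero_of_hasSum_dirichlet_of_isBigO (a := a - Pi.single 0 (h 0))
    (h := fun t => h t - h 0 * Complex.exp (-(t : ℂ))) (F := fun s => F s - h 0) hp hσ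
    (fun s hs => (hF s hs).sub_const _) ?_ ?_ ?_ ?_
  · exact sub_eq_zero.mp this
  · intro s hs
    refine ((hFs s hs).sub (hpi (h 0))).congr_fun ?_
    rintro (_ | k) <;> simp
  · exact hc.sub (by fun_prop)
  · intro t ht
    refine ((hsum t ht).sub (hpi (h 0 * Complex.exp (-(t : ℂ))))).congr_fun ?_
    rintro (_ | k) <;> simp [sub_mul]
  · simpa using hd.isBigO_sub.mono nhdsWithin_le_nhds

/-- Termwise differentiation of an exponential series on the right half-plane. -/
lemma hasSum_deriv_exp_series {c : ℕ → ℂ} {G : ℂ → ℂ}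
    (hG : ∀ z : ℂ, 0 < z.re →
      HasSum (fun k : ℕ => c k * Complex.exp (-(((k : ℂ) + 1) * z))) (G z))
    {z : ℂ} (hz : 0 < z.re) :
    HasSum (fun k : ℕ => -((k : ℂ) + 1) * c k * Complex.exp (-(((k : ℂ) + 1) * z)))
      (deriv G z) := by
  have hr : 0 < z.re / 2 := by linarith
  have hU : IsOpen {w : ℂ | z.re / 2 < w.re} := isOpen_lt continuous_const Complex.continuous_re
  have hzU : z ∈ {w : ℂ | z.re / 2 < w.re} := by simp only [Set.mem_ofPred_eq]; linarith
  have hs := (hG ((z.re / 2 : ℝ) : ℂ) (by simpa using hr)).summable.norm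
  have hnorm (w : ℂ) (k : ℕ) : ‖c k * Complex.exp (-(((k : ℂ) + 1) * w))‖ =
      ‖c k‖ * Real.exp (-(((k : ℝ) + 1) * w.re)) := by
    rw [norm_mul, Complex.norm_exp]; simp
  have key := Complex.hasSum_deriv_of_summable_norm
    (F := fun (k : ℕ) w => c k * Complex.exp (-(((k : ℂ) + 1) * w))) hs
    (fun k => by fun_prop) hU (fun k w hw => by
      rw [hnorm, hnorm, Complex.ofReal_re]
      have : z.re / 2 < w.re := hw
      gcongr) hzU
  have hev : (fun w : ℂ => ∑' k : ℕ, c k * Complex.exp (-(((k : ℂ) + 1) * w))) =ᶠ[𝓝 z] G := by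
    filter_upwards [hU.mem_nhds hzU] with w hw using (hG w (hr.trans hw)).tsum_eq
  rw [hev.deriv_eq] at key
  refine key.congr_fun fun k => ?_
  have h1 : HasDerivAt (fun w : ℂ => -(((k : ℂ) + 1) * w)) (-(((k : ℂ) + 1) * 1)) z :=
    ((hasDerivAt_id z).const_mul _).neg
  rw [(h1.cexp.const_mul (c k)).deriv]
  ring

/-- Iterated termwise differentiation of an exponential series on the right half-plane. -/
lemma hasSum_iteratedDeriv_exp_series {c : ℕ → ℂ} {G : ℂ → ℂ}
    (hG : ∀ z : ℂ, 0 < z.re →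
      HasSum (fun k : ℕ => c k * Complex.exp (-(((k : ℂ) + 1) * z))) (G z))
    (j : ℕ) : ∀ z : ℂ, 0 < z.re →
    HasSum (fun k : ℕ => (-((k : ℂ) + 1)) ^ j * c k * Complex.exp (-(((k : ℂ) + 1) * z)))
      (iteratedDeriv j G z) := by
  induction j with
  | zero => simpa using hG
  | succ j ih =>
    intro z hz
    rw [iteratedDeriv_succ]
    refine (hasSum_deriv_exp_series ih hz).congr_fun fun k => ?_
    ring

namespace DirichletCharacter

variable {f : ℕ} (χ : DirichletCharacter ℂ f)

/-- The rational function of `e ^ z` whose expansion in powers of `e ^ (-z)` is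
`2 * ∑ (-1) ^ n * χ n * e ^ (-n z)`. -/
noncomputable def eulerGenerating (z : ℂ) : ℂ :=
  (∑ k ∈ Finset.range f, 2 * (-1 : ℂ) ^ (k + 1) * χ ((k + 1 : ℕ) : ZMod f) *
    Complex.exp (-(((k : ℂ) + 1) * z))) / (1 + Complex.exp (-(f * z)))

lemma differentiableOn_eulerGenerating :
    DifferentiableOn ℂ (eulerGenerating χ) {z | 1 + Complex.exp (-(f * z)) ≠ 0} := by
  refine DifferentiableOn.div (by fun_prop) (by fun_prop) fun z hz => hz

lemma isOpen_one_add_exp_ne_zero (f : ℕ) : IsOpen {z : ℂ | 1 + Complex.exp (-(f * z)) ≠ 0} :=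
  isOpen_ne_fun (by fun_prop) continuous_const

lemma one_add_exp_ofReal_ne_zero (f : ℕ) (t : ℝ) : 1 + Complex.exp (-(f * (t : ℂ))) ≠ 0 := by
  have : 1 + Complex.exp (-(f * (t : ℂ))) = ((1 + Real.exp (-(f * t)) : ℝ) : ℂ) := by
    push_cast; rfl
  rw [this]
  exact_mod_cast (by positivity : 1 + Real.exp (-(f * t)) ≠ 0)

variable [NeZero f]

/-- The Euler `L`-function of a Dirichlet character. -/
noncomputable def eulerLFunction (s : ℂ) : ℂ :=
  -2 * (1 - χ (2 : ZMod f) * (2 : ℂ) ^ (1 - s)) * LFunction χ s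

lemma differentiableAt_eulerLFunction {s : ℂ} (hs : s ≠ 1) :
    DifferentiableAt ℂ (eulerLFunction χ) s := by
  have h2 : DifferentiableAt ℂ (fun s : ℂ => (2 : ℂ) ^ (1 - s)) s :=
    DifferentiableAt.const_cpow (by fun_prop) (Or.inl two_ne_zero)
  exact (((h2.const_mul _).const_sub _).const_mul _).mul
    (differentiableAt_LFunction χ s (Or.inl hs))

lemma hasSum_eulerLFunction {s : ℂ} (hs : 1 < s.re) :
    HasSum (fun k : ℕ => 2 * (-1 : ℂ) ^ (k + 1) * χ ((k + 1 : ℕ) : ZMod f) / ((k : ℂ) + 1) ^ s)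
      (eulerLFunction χ s) := by
  have hs0 : s ≠ 0 := by rintro rfl; simp at hs; linarith
  let T : ℕ → ℂ := LSeries.term (fun n => χ n) s
  have hT : HasSum T (LFunction χ s) := by
    rw [LFunction_eq_LSeries χ hs]
    exact (ZMod.LSeriesSummable_of_one_lt_re χ hs).LSeriesHasSum
  have hTn (n : ℕ) : T n = χ n / (n : ℂ) ^ s := LSeries.term_of_ne_zero' hs0 _ n
  have hTe : HasSum (fun n : ℕ => if _root_.Even n then T n else 0)
      (χ 2 * (2 : ℂ) ^ (-s) * LFunction χ s) := by
    have hinj : Function.Injective fun n : ℕ => 2 * n := mul_right_injective₀ two_ne_zero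
    rw [← hinj.hasSum_iff (fun n hn => if_neg fun ⟨m, hm⟩ => hn ⟨m, by simp; omega⟩)]
    refine (hT.mul_left _).congr_fun fun n => ?_
    have := Complex.natCast_mul_natCast_cpow 2 n s
    simp only [Function.comp_apply, even_two, Even.mul_right, if_true, hTn]
    push_cast at this ⊢
    rw [this, map_mul, Complex.cpow_neg]
    field_simp
  have hS : HasSum (fun n : ℕ => 2 * (-1 : ℂ) ^ n * T n) (eulerLFunction χ s) := by
    have hval : eulerLFunction χ s =
        4 * (χ 2 * (2 : ℂ) ^ (-s) * LFunction χ s) - 2 * LFunction χ s := by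
      rw [eulerLFunction, sub_eq_add_neg 1 s, Complex.cpow_add _ _ two_ne_zero, Complex.cpow_one]
      ring
    rw [hval]
    refine ((hTe.mul_left 4).sub (hT.mul_left 2)).congr_fun fun n => ?_
    rcases Nat.even_or_odd n with hn | hn
    · simp only [hn.neg_one_pow, hn, if_true]; ring
    · simp only [hn.neg_one_pow, Nat.not_even_iff_odd.mpr hn, if_false]; ring
  rw [← hasSum_nat_add_iff' 1] at hS
  have hT0 : T 0 = 0 := LSeries.term_zero ..
  simp only [Finset.range_one, Finset.sum_singleton, hT0, mul_zero, sub_zero] at hS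
  refine hS.congr_fun fun k => ?_
  rw [hTn]
  push_cast
  ring

lemma hasSum_eulerGenerating (hf : _root_.Odd f) {z : ℂ} (hz : 0 < z.re) :
    HasSum (fun k : ℕ => 2 * (-1 : ℂ) ^ (k + 1) * χ ((k + 1 : ℕ) : ZMod f) *
      Complex.exp (-(((k : ℂ) + 1) * z))) (eulerGenerating χ z) := by
  set b : ℕ → ℂ := fun k => 2 * (-1 : ℂ) ^ (k + 1) * χ ((k + 1 : ℕ) : ZMod f) *
      Complex.exp (-(((k : ℂ) + 1) * z)) with hb
  have hf0 : 0 < (f : ℝ) := by exact_mod_cast NeZero.pos f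
  have hbs : Summable b := by
    have hg : Summable fun k : ℕ => 2 * Real.exp (-z.re) ^ k :=
      (summable_geometric_of_lt_one (Real.exp_pos _).le
        (Real.exp_lt_one_iff.mpr (by linarith))).mul_left 2
    refine Summable.of_norm_bounded hg fun k => ?_
    rw [hb, ← Real.exp_nat_mul]
    simp only [norm_mul, norm_pow, norm_neg, norm_one, one_pow, mul_one, Complex.norm_exp,
      Complex.norm_ofNat]
    have h1 := χ.norm_le_one ((k + 1 : ℕ) : ZMod f)
    have h2 : (-(((k : ℂ) + 1) * z)).re ≤ k * -z.re := by
      simp; linarith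
    calc _ ≤ 2 * 1 * Real.exp (k * -z.re) := by gcongr
      _ = _ := by ring
  have hshift (k : ℕ) : b (k + f) = -Complex.exp (-(f * z)) * b k := by
    have h1 : ((k + f + 1 : ℕ) : ZMod f) = ((k + 1 : ℕ) : ZMod f) := by push_cast; simp
    have h2 : (-1 : ℂ) ^ (k + f + 1) = -(-1) ^ (k + 1) := by
      rw [add_right_comm, pow_add _ (k + 1) f, hf.neg_one_pow]; ring
    have h3 : Complex.exp (-((((k + f : ℕ) : ℂ) + 1) * z)) =
        Complex.exp (-(f * z)) * Complex.exp (-(((k : ℂ) + 1) * z)) := by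
      rw [← Complex.exp_add]; push_cast; ring_nf
    simp only [hb, h1, h2, h3]
    ring
  have hne : 1 + Complex.exp (-(f * z)) ≠ 0 := by
    intro h
    have h1 : ‖Complex.exp (-(f * z))‖ = 1 := by
      rw [eq_neg_of_add_eq_zero_right h]; simp
    rw [Complex.norm_exp, Real.exp_eq_one_iff] at h1
    simp at h1
    rcases h1 with h1 | h1
    · exact NeZero.ne f h1
    · linarith
  have h := hbs.sum_add_tsum_nat_add f
  simp_rw [hshift, tsum_mul_left] at h
  have : eulerGenerating χ z = ∑' k, b k := by
    rw [eulerGenerating, div_eq_iff hne]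
    linear_combination h
  rw [this]
  exact hbs.hasSum

lemma eulerLFunction_neg_nat (hf : _root_.Odd f) (j : ℕ) :
    eulerLFunction χ (-(j : ℂ)) = (-1) ^ j * iteratedDeriv j (eulerGenerating χ) 0 := by
  have hd : DifferentiableOn ℂ (iteratedDeriv j (eulerGenerating χ))
      {z | 1 + Complex.exp (-(f * z)) ≠ 0} := by
    induction j with
    | zero => simpa using differentiableOn_eulerGenerating χ
    | succ j ih =>
      rw [iteratedDeriv_succ]
      exact ih.deriv (isOpen_one_add_exp_ne_zero f)
  have hdr (t : ℝ) : DifferentiableAt ℝ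
      (fun t : ℝ => (-1) ^ j * iteratedDeriv j (eulerGenerating χ) (t : ℂ)) t := by
    have h1 := hd.differentiableAt
      ((isOpen_one_add_exp_ne_zero f).mem_nhds (one_add_exp_ofReal_ne_zero f t))
    exact (h1.hasDerivAt.comp_ofReal.differentiableAt).const_mul _
  have := eq_of_hasSum_dirichlet_of_differentiableAt
    (a := fun k => 2 * (-1 : ℂ) ^ (k + 1) * χ ((k + 1 : ℕ) : ZMod f) * ((k : ℂ) + 1) ^ j)
    (F := fun s => eulerLFunction χ (s - j))
    (h := fun t : ℝ => (-1) ^ j * iteratedDeriv j (eulerGenerating χ) (t : ℂ))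
    (p := 1 + j) (σ := 1 + j) (by simp) (by positivity) ?_ ?_ ?_ ?_ (hdr 0)
  · simpa using this
  · intro s hs
    refine DifferentiableAt.comp (g := eulerLFunction χ) s
      (differentiableAt_eulerLFunction χ fun h => hs ?_) (by fun_prop)
    push_cast
    linear_combination h
  · intro s hs
    refine (hasSum_eulerLFunction χ (s := s - j) (by simp; linarith)).congr_fun fun k => ?_
    have hk : (k : ℂ) + 1 ≠ 0 := by exact_mod_cast k.succ_ne_zero
    rw [Complex.cpow_sub _ _ hk, Complex.cpow_natCast]
    field_simp
  · exact fun t _ => (hdr t).continuousAt.continuousWithinAt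
  · intro t ht
    refine ((hasSum_iteratedDeriv_exp_series (fun z hz => hasSum_eulerGenerating χ hf hz) j t
      (by simpa using ht)).mul_left ((-1) ^ j)).congr_fun fun k => ?_
    have hsq : (-1 : ℂ) ^ j * (-1) ^ j = 1 := by rw [← mul_pow]; simp
    rw [neg_pow ((k : ℂ) + 1)]
    linear_combination (-(2 * (-1 : ℂ) ^ (k + 1) * χ ((k + 1 : ℕ) : ZMod f) * ((k : ℂ) + 1) ^ j *
      Complex.exp (-(((k : ℂ) + 1) * t)))) * hsq

lemma one_add_exp_ne_zero_of_mem_ball {z : ℂ} (hz : z ∈ Metric.ball (0 : ℂ) (Real.pi / f)) :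
    1 + Complex.exp (-(f * z)) ≠ 0 := by
  intro h
  have hf0 : 0 < (f : ℝ) := by exact_mod_cast NeZero.pos f
  have h1 : Complex.exp (-(f * z) + Real.pi * Complex.I) = 1 := by
    rw [Complex.exp_add, Complex.exp_pi_mul_I, eq_neg_of_add_eq_zero_right h]; simp
  obtain ⟨n, hn⟩ := Complex.exp_eq_one_iff.mp h1
  have h2 : (f * z : ℂ) = ((1 - 2 * n : ℤ) : ℝ) * (Real.pi * Complex.I) := by
    push_cast; linear_combination -hn
  have h3 := congrArg norm h2
  simp only [norm_mul, Complex.norm_natCast, Complex.norm_I, mul_one, Complex.norm_real,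
    Real.norm_eq_abs, abs_of_pos Real.pi_pos] at h3
  have h4 : (1 : ℝ) ≤ |((1 - 2 * n : ℤ) : ℝ)| := by
    rw [← Int.cast_abs]
    exact_mod_cast Int.one_le_abs (by omega)
  rw [mem_ball_zero_iff, lt_div_iff₀ hf0] at hz
  nlinarith [Real.pi_pos]

end DirichletCharacter


open Finset

/-- Let `χ` be a primitive Dirichlet character of odd conductor
`f`. For all real `t` with `0 < t < π/f`, both series below converge and
`2 ∑_{n=1}^∞ (−1)^n χ(n) e^{−nt} = ∑_{j=0}^∞ L_E(−j,χ) (−t)^j/j!`, where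
`L_E(−j,χ) := −2(1 − χ(2)·2^{1+j}) L(−j,χ)` is the value at `−j` of the
analytic continuation of the Euler `L`-function of `χ`, expressed through the
analytically continued Dirichlet `L`-function `L(·,χ)`.
(The first series is indexed by `n = k + 1`, `k : ℕ`.) -/
theorem statement8 (f : ℕ) [NeZero f] (hf : Odd f) (χ : DirichletCharacter ℂ f)
    (hχ : χ.IsPrimitive) (t : ℝ) (ht0 : 0 < t) (ht : t < Real.pi / f) :
    ∃ S : ℂ,
      HasSum (fun k : ℕ => 2 * (-1 : ℂ) ^ (k + 1) * χ ((k + 1 : ℕ) : ZMod f) *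
        Complex.exp (-(((k + 1 : ℕ) : ℂ) * (t : ℂ)))) S ∧
      HasSum (fun j : ℕ =>
        (-2 * (1 - χ (2 : ZMod f) * (2 : ℂ) ^ (1 + j)) *
          DirichletCharacter.LFunction χ (-(j : ℂ))) *
          (-(t : ℂ)) ^ j / (j.factorial : ℂ)) S := by
  refine ⟨DirichletCharacter.eulerGenerating χ t, ?_, ?_⟩
  · simpa using DirichletCharacter.hasSum_eulerGenerating χ hf (z := t) (by simpa using ht0)
  · have hball : (t : ℂ) ∈ Metric.ball (0 : ℂ) (Real.pi / f) := by
      simpa [abs_of_pos ht0] using ht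
    have hd : DifferentiableOn ℂ (DirichletCharacter.eulerGenerating χ)
        (Metric.ball (0 : ℂ) (Real.pi / f)) :=
      (DirichletCharacter.differentiableOn_eulerGenerating χ).mono fun z hz =>
        DirichletCharacter.one_add_exp_ne_zero_of_mem_ball hz
    refine (Complex.hasSum_taylorSeries_on_ball hd hball).congr_fun fun j => ?_
    have hj := DirichletCharacter.eulerLFunction_neg_nat χ hf j
    rw [DirichletCharacter.eulerLFunction, sub_neg_eq_add,
      show (1 + (j : ℂ)) = ((1 + j : ℕ) : ℂ) by push_cast; rfl, Complex.cpow_natCast] at hj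
    have hsq : (-1 : ℂ) ^ j * (-1) ^ j = 1 := by rw [← mul_pow]; simp
    rw [hj, neg_pow (t : ℂ), sub_zero, smul_eq_mul, smul_eq_mul, div_eq_inv_mul]
    linear_combination ((j.factorial : ℂ)⁻¹ * (t : ℂ) ^ j *
      iteratedDeriv j (DirichletCharacter.eulerGenerating χ) 0) * hsq
end

section
/- Let χ be a primitive Dirichlet character of odd conductor f > 1. Then E_{0,χ} := ∑_{a=1}^{f} (−1)^a χ(a) ≠ 0 if and only if χ is odd, i.e., χ(−1) = −1. -/
open Finset

namespace DirichletCharacter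

open Complex Filter Topology Asymptotics

variable {f : ℕ}

lemma sum_Icc_neg_one_pow_mul (hf1 : 1 < f) (χ : DirichletCharacter ℂ f) :
    ∑ a ∈ Finset.Icc 1 f, (-1 : ℂ) ^ a * χ ((a : ℕ) : ZMod f) =
      ∑ a ∈ range f, (-1 : ℂ) ^ a * χ (a : ZMod f) := by
  have h0 : χ 0 = 0 := χ.map_zero' hf1.ne'
  have h : ∑ a ∈ range (f + 1), (-1 : ℂ) ^ a * χ (a : ZMod f) =
      ∑ a ∈ Finset.Icc 1 f, (-1 : ℂ) ^ a * χ (a : ZMod f) := by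
    rw [← Finset.Ico_add_one_right_eq_Icc, Finset.sum_Ico_eq_sub _ (by omega)]
    simp [h0]
  rw [← h, sum_range_succ]
  simp [h0]

lemma Even.sum_neg_one_pow_mul_eq_zero (hf : _root_.Odd f) (hf1 : 1 < f)
    {χ : DirichletCharacter ℂ f} (hχ : χ.Even) :
    ∑ a ∈ range f, (-1 : ℂ) ^ a * χ (a : ZMod f) = 0 := by
  have h0 : χ 0 = 0 := χ.map_zero' hf1.ne'
  have h : ∑ a ∈ range (f + 1), (-1 : ℂ) ^ a * χ (a : ZMod f) =
      ∑ a ∈ range f, (-1 : ℂ) ^ a * χ (a : ZMod f) := by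
    rw [sum_range_succ]; simp [h0]
  have h' : ∑ a ∈ range (f + 1), (-1 : ℂ) ^ a * χ (a : ZMod f) =
      -∑ a ∈ range (f + 1), (-1 : ℂ) ^ a * χ (a : ZMod f) := by
    conv_lhs => rw [← sum_range_reflect]
    rw [← sum_neg_distrib]
    refine sum_congr rfl fun a ha ↦ ?_
    have haf : a ≤ f := by simpa [Nat.lt_succ_iff] using ha
    have hs : (-1 : ℂ) ^ (f - a) = -(-1) ^ a := by
      rcases Nat.even_or_odd a with hev | hodd
      · rw [(Nat.Odd.sub_even haf hf hev).neg_one_pow, hev.neg_one_pow]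
      · rw [(Nat.Odd.sub_odd hf hodd).neg_one_pow, hodd.neg_one_pow, neg_neg]
    rw [Nat.add_sub_cancel, hs, Nat.cast_sub haf, ZMod.natCast_self, zero_sub, hχ.eval_neg,
      neg_mul]
  rw [← h]
  exact self_eq_neg.mp h'

/-- The generating function `∑ (-1) ^ n χ(n) exp (-n t)` in closed form. -/
noncomputable def alternatingTheta (χ : DirichletCharacter ℂ f) (t : ℝ) : ℂ :=
  (∑ a ∈ range f, (-1 : ℂ) ^ a * χ (a : ZMod f) * Real.exp (-a * t)) / (1 + Real.exp (-f * t))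

lemma one_add_exp_ne_zero (x : ℝ) : (1 + Real.exp x : ℂ) ≠ 0 := by
  exact_mod_cast (by positivity : 1 + Real.exp x ≠ 0)

lemma hasSum_alternatingTheta (hf : _root_.Odd f) (χ : DirichletCharacter ℂ f) {t : ℝ}
    (ht : 0 < t) :
    HasSum (fun n : ℕ ↦ (-1 : ℂ) ^ n * χ (n : ZMod f) * Real.exp (-n * t))
      (alternatingTheta χ t) := by
  set u : ℕ → ℂ := fun n ↦ (-1 : ℂ) ^ n * χ (n : ZMod f) * Real.exp (-n * t) with hu
  have hsum : Summable u := by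
    have hg : Summable fun n : ℕ ↦ Real.exp (-n * t) := by
      simpa [mul_comm] using Real.summable_exp_nat_mul_iff.mpr (neg_lt_zero.mpr ht)
    refine hg.of_norm_bounded fun n ↦ ?_
    rw [hu, norm_mul, norm_mul, norm_pow, norm_neg, norm_one, one_pow, one_mul, norm_real,
      Real.norm_of_nonneg (Real.exp_pos _).le]
    exact mul_le_of_le_one_left (Real.exp_pos _).le (χ.norm_le_one _)
  have hshift (n : ℕ) : u (n + f) = -Real.exp (-f * t) * u n := by
    have he : Real.exp (-(n + f : ℕ) * t) = Real.exp (-f * t) * Real.exp (-n * t) := by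
      rw [← Real.exp_add]; push_cast; ring_nf
    simp only [hu]
    rw [he, pow_add, hf.neg_one_pow, Nat.cast_add, ZMod.natCast_self, add_zero, ofReal_mul]
    ring
  have key := hsum.sum_add_tsum_nat_add f
  simp_rw [hshift, tsum_mul_left] at key
  have : alternatingTheta χ t = ∑' n, u n := by
    rw [alternatingTheta, div_eq_iff (one_add_exp_ne_zero _)]
    linear_combination key
  rw [this]
  exact hsum.hasSum

lemma differentiable_alternatingTheta (χ : DirichletCharacter ℂ f) :
    Differentiable ℝ (alternatingTheta χ) := by
  have h (c : ℝ) : Differentiable ℝ fun t : ℝ ↦ (Real.exp (c * t) : ℂ) := fun t ↦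
    (((hasDerivAt_id t).const_mul c).exp.ofReal_comp).differentiableAt
  refine Differentiable.fun_div (Differentiable.fun_sum fun a _ ↦ (h _).const_mul _)
    ((h _).const_add _) fun t ↦ one_add_exp_ne_zero _

lemma alternatingTheta_isBigO_atTop (hf1 : 1 < f) (χ : DirichletCharacter ℂ f) :
    alternatingTheta χ =O[atTop] fun t ↦ Real.exp (-1 * t) := by
  refine IsBigO.of_bound f ?_
  filter_upwards [eventually_ge_atTop 0] with t ht
  have hden : 1 ≤ ‖(1 + Real.exp (-f * t) : ℂ)‖ := by
    rw [← ofReal_one, ← ofReal_add, norm_real, Real.norm_of_nonneg (by positivity)]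
    linarith [Real.exp_pos (-f * t)]
  rw [alternatingTheta, norm_div, Real.norm_of_nonneg (Real.exp_pos _).le]
  refine (div_le_self (norm_nonneg _) hden).trans ?_
  calc
    _ ≤ ∑ _a ∈ range f, Real.exp (-1 * t) := norm_sum_le_of_le _ fun a _ ↦ ?_
    _ = f * Real.exp (-1 * t) := by simp
  rcases a.eq_zero_or_pos with rfl | ha
  · simp [χ.map_zero' hf1.ne', (Real.exp_pos _).le]
  · have ha' : (1 : ℝ) ≤ a := by exact_mod_cast ha
    rw [norm_mul, norm_mul, norm_pow, norm_neg, norm_one, one_pow, one_mul, norm_real,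
      Real.norm_of_nonneg (Real.exp_pos _).le]
    refine (mul_le_of_le_one_left (Real.exp_pos _).le (χ.norm_le_one _)).trans ?_
    gcongr

lemma alternatingTheta_isBigO_zero {χ : DirichletCharacter ℂ f}
    (h : ∑ a ∈ range f, (-1 : ℂ) ^ a * χ (a : ZMod f) = 0) :
    alternatingTheta χ =O[𝓝[>] 0] fun t ↦ t ^ (-(-1 : ℝ)) := by
  have h0 : alternatingTheta χ 0 = 0 := by simp [alternatingTheta, h]
  have := (differentiable_alternatingTheta χ 0).isBigO_sub
  simp only [h0, sub_zero] at this
  simpa using this.mono nhdsWithin_le_nhds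

lemma differentiableAt_mellin_alternatingTheta (hf1 : 1 < f) {χ : DirichletCharacter ℂ f}
    (h : ∑ a ∈ range f, (-1 : ℂ) ^ a * χ (a : ZMod f) = 0) {s : ℂ} (hs : -1 < s.re) :
    DifferentiableAt ℂ (mellin (alternatingTheta χ)) s :=
  mellin_differentiableAt_of_isBigO_rpow_exp one_pos
    ((differentiable_alternatingTheta χ).continuous.continuousOn.locallyIntegrableOn
      measurableSet_Ioi)
    (alternatingTheta_isBigO_atTop hf1 χ) (alternatingTheta_isBigO_zero h) hs

/-- The alternating Dirichlet series of `χ` in terms of its L-function. -/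
lemma tsum_neg_one_pow_mul_div_cpow (hf1 : 1 < f) [NeZero f] (χ : DirichletCharacter ℂ f) {s : ℂ}
    (hs : 1 < s.re) :
    ∑' n : ℕ, (-1 : ℂ) ^ n * χ (n : ZMod f) / (n : ℂ) ^ s =
      (2 * (2 : ℂ) ^ (-s) * χ 2 - 1) * LFunction χ s := by
  set c : ℕ → ℂ := fun n ↦ χ (n : ZMod f) / (n : ℂ) ^ s with hc
  have hterm : LSeries.term (χ ·) s = c := by
    ext n
    rw [LSeries.term_def₀ (by simpa using χ.map_zero' hf1.ne'), cpow_neg, ← div_eq_mul_inv]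
  have hsum : Summable c := hterm ▸ LSeriesSummable_of_one_lt_re χ hs
  have hL : LFunction χ s = ∑' n, c n := by
    rw [LFunction_eq_LSeries χ hs, LSeries, hterm]
  have hev (n : ℕ) : c (2 * n) = (2 : ℂ) ^ (-s) * χ 2 * c n := by
    simp only [hc]
    rw [Nat.cast_mul, Nat.cast_mul, natCast_mul_natCast_cpow, map_mul, Nat.cast_ofNat,
      Nat.cast_ofNat, cpow_neg]
    field_simp
  have hse : Summable fun n ↦ c (2 * n) :=
    hsum.comp_injective (mul_right_injective₀ two_ne_zero)
  have hso : Summable fun n ↦ c (2 * n + 1) :=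
    hsum.comp_injective ((add_left_injective 1).comp (mul_right_injective₀ two_ne_zero))
  have h1 := tsum_even_add_odd hse hso
  have h2 := tsum_even_add_odd (f := fun n ↦ (-1 : ℂ) ^ n * c n)
    (by simpa [pow_mul] using hse) (by simpa [pow_succ, pow_mul] using hso.neg)
  simp only [(even_two_mul _).neg_one_pow, (even_two_mul _).add_one.neg_one_pow, one_mul,
    neg_one_mul, tsum_neg] at h2
  simp only [mul_div_assoc]
  rw [hL, ← h2]
  simp_rw [hev, tsum_mul_left] at h1 ⊢
  linear_combination -h1

lemma mellin_alternatingTheta (hf : _root_.Odd f) (hf1 : 1 < f) [NeZero f]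
    (χ : DirichletCharacter ℂ f) {s : ℂ} (hs : 1 < s.re) :
    mellin (alternatingTheta χ) s =
      Gamma s * ((2 * (2 : ℂ) ^ (-s) * χ 2 - 1) * LFunction χ s) := by
  have h0 : χ 0 = 0 := χ.map_zero' hf1.ne'
  have key := hasSum_mellin (a := fun n : ℕ ↦ (-1 : ℂ) ^ n * χ (n : ZMod f))
    (p := fun n ↦ (n : ℝ)) (F := alternatingTheta χ) (s := s) (fun n ↦ ?_) (by linarith)
    (fun t ht ↦ hasSum_alternatingTheta hf χ ht) ?_
  · rw [← key.tsum_eq, ← tsum_neg_one_pow_mul_div_cpow hf1 χ hs, ← tsum_mul_left]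
    simp [mul_div_assoc]
  · rcases n.eq_zero_or_pos with rfl | hn
    · simp [h0]
    · exact .inr (by exact_mod_cast hn)
  · refine (Real.summable_one_div_nat_rpow.mpr hs).of_nonneg_of_le (fun n ↦ by positivity)
      fun n ↦ ?_
    gcongr
    simpa using χ.norm_le_one _

/-- If the alternating sum of `χ` vanishes, then so does the L-function of `χ` at `0`. -/
lemma LFunction_apply_zero_eq_zero (hf : _root_.Odd f) (hf1 : 1 < f) [NeZero f]
    {χ : DirichletCharacter ℂ f} (hχ : χ ≠ 1)
    (h : ∑ a ∈ range f, (-1 : ℂ) ^ a * χ (a : ZMod f) = 0) :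
    LFunction χ 0 = 0 := by
  let U : Set ℂ := {s | -1 < s.re}
  have hU : IsOpen U := isOpen_lt continuous_const continuous_re
  have hUc : IsPreconnected U := (convex_halfSpace_re_gt (-1)).isPreconnected
  have hA : AnalyticOnNhd ℂ (fun s ↦ (Gamma s)⁻¹ * mellin (alternatingTheta χ) s) U :=
    DifferentiableOn.analyticOnNhd (fun s hs ↦ ((differentiable_one_div_Gamma s).mul
      (differentiableAt_mellin_alternatingTheta hf1 h hs)).differentiableWithinAt) hU
  have hB : AnalyticOnNhd ℂ (fun s ↦ (2 * (2 : ℂ) ^ (-s) * χ 2 - 1) * LFunction χ s) U := by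
    refine DifferentiableOn.analyticOnNhd (fun s _ ↦ ?_) hU
    have hL := differentiable_LFunction hχ s
    have h2 : DifferentiableAt ℂ (fun s : ℂ ↦ (2 : ℂ) ^ (-s)) s :=
      differentiableAt_id.neg.const_cpow (.inl two_ne_zero)
    exact ((((h2.const_mul 2).mul_const _).sub_const 1).mul hL).differentiableWithinAt
  have hAB : (fun s ↦ (Gamma s)⁻¹ * mellin (alternatingTheta χ) s) =ᶠ[𝓝 2]
      fun s ↦ (2 * (2 : ℂ) ^ (-s) * χ 2 - 1) * LFunction χ s := by
    filter_upwards [(isOpen_lt continuous_const continuous_re).mem_nhds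
      (show (1 : ℝ) < (2 : ℂ).re by simp)] with s hs
    have hs : 1 < s.re := hs
    rw [mellin_alternatingTheta hf hf1 χ hs,
      inv_mul_cancel_left₀ (Gamma_ne_zero_of_re_pos (by linarith))]
  have := hA.eqOn_of_preconnected_of_eventuallyEq hB hUc (show (2 : ℂ) ∈ U by simp [U]; norm_num)
    hAB (show (0 : ℂ) ∈ U by simp [U])
  simp only [Gamma_zero, inv_zero, zero_mul, neg_zero, cpow_zero, mul_one] at this
  refine (mul_eq_zero.mp this.symm).resolve_left fun h2 ↦ ?_
  have hu : IsUnit (2 : ZMod f) := by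
    exact_mod_cast (ZMod.isUnit_iff_coprime 2 f).mpr hf.coprime_two_left
  have hn : ‖χ 2‖ = 1 := by
    obtain ⟨v, hv⟩ := hu
    rw [← hv]
    exact χ.unit_norm_eq_one v
  have := congrArg norm (sub_eq_zero.mp h2)
  rw [norm_mul, hn] at this
  norm_num at this

/-- The L-function of an odd primitive Dirichlet character does not vanish at `0`. -/
lemma Odd.LFunction_apply_zero_ne_zero [NeZero f] {χ : DirichletCharacter ℂ f} (hodd : χ.Odd)
    (hχ : χ.IsPrimitive) : LFunction χ 0 ≠ 0 := by
  intro h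
  have hf1 : f ≠ 1 := by
    rintro rfl
    have h1 : χ (-1) = -1 := hodd
    rw [Subsingleton.elim (-1 : ZMod 1) 1, map_one] at h1
    norm_num at h1
  have hχ1 : χ⁻¹ ≠ 1 := by
    rw [inv_ne_one]
    rintro rfl
    exact hf1 (by rw [← hχ, conductor_one])
  have hc : completedLFunction χ 0 = 0 := by
    rw [LFunction_eq_completed_div_gammaFactor χ 0 (.inr hf1), hodd.gammaFactor_def, zero_add,
      Gammaℝ_one, div_one] at h
    exact h
  have hinv : χ⁻¹.IsPrimitive := by rw [isPrimitive_def, conductor_inv, hχ]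
  have hfe := hinv.completedLFunction_one_sub 0
  rw [inv_inv, hc, mul_zero, sub_zero] at hfe
  refine LFunction_apply_one_ne_zero hχ1 ?_
  rw [LFunction_eq_completed_div_gammaFactor _ 1 (.inl one_ne_zero), hfe, zero_div]

end DirichletCharacter

/-- Let `χ` be a primitive Dirichlet character of odd conductor
`f > 1` (with values in `ℂ`). Then `E_{0,χ} = ∑_{a=1}^f (−1)^a χ(a) ≠ 0` if and
only if `χ` is odd, i.e. `χ(−1) = −1`. -/
theorem statement9 (f : ℕ) (hf : Odd f) (hf1 : 1 < f) (χ : DirichletCharacter ℂ f)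
    (hχ : χ.IsPrimitive) :
    (∑ a ∈ Finset.Icc 1 f, (-1 : ℂ) ^ a * χ ((a : ℕ) : ZMod f)) ≠ 0 ↔ χ (-1) = -1 := by
  have : NeZero f := ⟨by omega⟩
  rw [DirichletCharacter.sum_Icc_neg_one_pow_mul hf1]
  refine ⟨fun h ↦ χ.even_or_odd.resolve_left fun hev ↦
    h (hev.sum_neg_one_pow_mul_eq_zero hf hf1), fun hodd h ↦ ?_⟩
  have hχ1 : χ ≠ 1 := by
    rintro rfl
    rw [DirichletCharacter.isPrimitive_def, DirichletCharacter.conductor_one] at hχ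
    omega
  exact DirichletCharacter.Odd.LFunction_apply_zero_ne_zero hodd hχ
    (DirichletCharacter.LFunction_apply_zero_eq_zero hf hf1 hχ1 h)
end

section
/- Let p be an odd prime and let (c_i)_{i≥0} be a sequence in ℂ_p with ‖c_i‖ ≤ 1 for all i. Suppose there is λ ∈ ℕ with ‖c_i‖ < 1 for all i < λ and ‖c_λ‖ = 1. Then there exists n_0 such that for all n ≥ n_0 and every primitive p^n-th root of unity ζ ∈ ℂ_p, the series ∑_{i=0}^∞ c_i (ζ − 1)^i converges in ℂ_p and ord_p( ∑_{i=0}^∞ c_i (ζ − 1)^i ) = λ · ord_p(ζ − 1) = λ / (p^{n−1}(p − 1)). -/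
open Polynomial in
/-- The product of `1 - μ` over the primitive `p ^ (k + 1)`-th roots of unity `μ` is `p`. -/
lemma IsPrimitiveRoot.prod_one_sub_primitiveRoots {R : Type*} [CommRing R] [IsDomain R]
    {p k : ℕ} [Fact p.Prime] {ζ : R} (hζ : IsPrimitiveRoot ζ (p ^ (k + 1))) :
    ∏ μ ∈ primitiveRoots (p ^ (k + 1)) R, (1 - μ) = p := by
  rw [← eval_one_cyclotomic_prime_pow (R := R) (p := p) k,
    cyclotomic_eq_prod_X_sub_primitiveRoots hζ, eval_prod]
  simp

lemma summable_mul_pow_of_norm_lt_one {K : Type*} [NormedField K] [CompleteSpace K]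
    {c : ℕ → K} (hc : ∀ i, ‖c i‖ ≤ 1) {x : K} (hx : ‖x‖ < 1) :
    Summable fun i => c i * x ^ i := by
  refine .of_norm_bounded (summable_geometric_of_lt_one (norm_nonneg x) hx) fun i => ?_
  rw [norm_mul, norm_pow]
  exact mul_le_of_le_one_left (by positivity) (hc i)

section Ultrametric

variable {K : Type*} [NormedField K] [IsUltrametricDist K]

lemma norm_pow_sub_one_le {x : K} (hx : ‖x‖ ≤ 1) (j : ℕ) : ‖x ^ j - 1‖ ≤ ‖x - 1‖ := by
  rw [← mul_geom_sum, norm_mul]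
  refine mul_le_of_le_one_right (norm_nonneg _) ?_
  refine IsUltrametricDist.norm_sum_le_of_forall_le_of_nonneg zero_le_one fun i _ => ?_
  rw [norm_pow]
  exact pow_le_one₀ (norm_nonneg _) hx

lemma IsPrimitiveRoot.norm_sub_one_eq {n : ℕ} [NeZero n] {ζ η : K}
    (hζ : IsPrimitiveRoot ζ n) (hη : IsPrimitiveRoot η n) : ‖η - 1‖ = ‖ζ - 1‖ := by
  have key : ∀ {x y : K}, IsPrimitiveRoot x n → IsPrimitiveRoot y n → ‖y - 1‖ ≤ ‖x - 1‖ := by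
    intro x y hx hy
    obtain ⟨j, -, rfl⟩ := hx.eq_pow_of_pow_eq_one hy.pow_eq_one
    refine norm_pow_sub_one_le (le_of_eq ?_) j
    rw [← pow_eq_one_iff_of_nonneg (norm_nonneg x) (NeZero.ne n), ← norm_pow, hx.pow_eq_one,
      norm_one]
  exact le_antisymm (key hζ hη) (key hη hζ)

lemma IsPrimitiveRoot.norm_sub_one_pow_eq {p k : ℕ} [Fact p.Prime] {ζ : K}
    (hζ : IsPrimitiveRoot ζ (p ^ (k + 1))) : ‖ζ - 1‖ ^ (p ^ k * (p - 1)) = ‖(p : K)‖ := by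
  have : NeZero (p ^ (k + 1)) := ⟨pow_ne_zero _ (Fact.out : p.Prime).ne_zero⟩
  rw [← hζ.prod_one_sub_primitiveRoots, norm_prod, ← Nat.totient_prime_pow_succ Fact.out,
    ← hζ.card_primitiveRoots, eq_comm]
  refine Finset.prod_eq_pow_card fun μ hμ => ?_
  rw [norm_sub_rev]
  exact hζ.norm_sub_one_eq (isPrimitiveRoot_of_mem_primitiveRoots hμ)

/-- A summable family with one term whose norm exceeds that of all others by a uniform gap
has a sum of the same norm as that term. -/
lemma norm_tsum_eq_of_forall_ne_le {ι : Type*} {f : ι → K} (hf : Summable f) (m : ι) {C : ℝ}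
    (hC : 0 ≤ C) (hCm : C < ‖f m‖) (h : ∀ i ≠ m, ‖f i‖ ≤ C) : ‖∑' i, f i‖ = ‖f m‖ := by
  classical
  rw [hf.tsum_eq_add_tsum_ite m]
  have hrest : ‖∑' i, if i = m then 0 else f i‖ ≤ C := by
    refine IsUltrametricDist.norm_tsum_le_of_forall_le_of_nonneg hC fun i => ?_
    split_ifs with hi
    · simpa using hC
    · exact h i hi
  have hlt := hrest.trans_lt hCm
  rw [IsUltrametricDist.norm_add_eq_max_of_norm_ne_norm hlt.ne', max_eq_left hlt.le]

/-- The terms before the leading one are dominated as soon as their coefficients are bounded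
by some `M < ‖x‖ ^ m`. -/
lemma norm_tsum_mul_pow_eq [CompleteSpace K] {c : ℕ → K} (hc : ∀ i, ‖c i‖ ≤ 1) {m : ℕ}
    (hm : ‖c m‖ = 1) {x : K} (hx0 : x ≠ 0) (hx : ‖x‖ < 1) {M : ℝ}
    (hM : ∀ i < m, ‖c i‖ ≤ M) (hMx : M < ‖x‖ ^ m) :
    ‖∑' i, c i * x ^ i‖ = ‖x‖ ^ m := by
  have hpos := norm_pos_iff.mpr hx0
  have hlead : ‖c m * x ^ m‖ = ‖x‖ ^ m := by rw [norm_mul, norm_pow, hm, one_mul]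
  rw [← hlead]
  refine norm_tsum_eq_of_forall_ne_le (summable_mul_pow_of_norm_lt_one hc hx) m
    (C := max M (‖x‖ ^ (m + 1))) (le_max_of_le_right (by positivity)) ?_ fun i hi => ?_
  · rw [hlead]
    exact max_lt hMx (pow_lt_pow_right_of_lt_one₀ hpos hx m.lt_succ_self)
  · rw [norm_mul, norm_pow]
    rcases hi.lt_or_gt with hi | hi
    · exact le_max_of_le_left ((mul_le_of_le_one_right (norm_nonneg _)
        (pow_le_one₀ hpos.le hx.le)).trans (hM i hi))
    · exact le_max_of_le_right ((mul_le_of_le_one_left (by positivity) (hc i)).trans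
        (pow_le_pow_of_le_one hpos.le hx.le hi))

end Ultrametric

lemma exists_forall_lt_norm_le {E : Type*} [SeminormedAddCommGroup E] {c : ℕ → E} {m : ℕ}
    (h : ∀ i < m, ‖c i‖ < 1) : ∃ M : ℝ, 0 ≤ M ∧ M < 1 ∧ ∀ i < m, ‖c i‖ ≤ M := by
  refine ⟨((Finset.range m).sup fun i => ‖c i‖₊ : NNReal), NNReal.coe_nonneg _, ?_, fun i hi => ?_⟩
  · rw [← NNReal.coe_one, NNReal.coe_lt_coe, Finset.sup_lt_iff (by simp)]
    exact fun i hi => h i (Finset.mem_range.mp hi)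
  · exact NNReal.coe_le_coe.mpr
      (Finset.le_sup (f := fun i => ‖c i‖₊) (Finset.mem_range.mpr hi))

/-- Let `p` be an odd prime and work in `ℂ_p`, modelled as a
complete, algebraically closed, nonarchimedean normed field `K` whose norm
extends the `p`-adic norm of `ℚ_p`; write `ord_p x = −log‖x‖/log p` (so that
`ord_p p = 1`). Let `(c_i)` be a sequence in `K` with `‖c_i‖ ≤ 1` for all `i`,
and let `λ ∈ ℕ` satisfy `‖c_i‖ < 1` for `i < λ` and `‖c_λ‖ = 1`. Then there is
`n₀` such that for all `n ≥ n₀` and every primitive `p^n`-th root of unity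
`ζ ∈ K`, the series `∑_{i=0}^∞ c_i (ζ − 1)^i` converges and
`ord_p (∑ c_i (ζ−1)^i) = λ · ord_p(ζ − 1) = λ / (p^{n−1}(p − 1))`. -/
theorem statement12 (p : ℕ) [Fact p.Prime] (hp2 : p ≠ 2)
    (K : Type*) [NontriviallyNormedField K] [IsAlgClosed K] [CompleteSpace K]
    [IsUltrametricDist K] [Algebra ℚ_[p] K]
    (hnorm : ∀ x : ℚ_[p], ‖algebraMap ℚ_[p] K x‖ = ‖x‖)
    (c : ℕ → K) (hc : ∀ i, ‖c i‖ ≤ 1)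
    (lam : ℕ) (hlt : ∀ i < lam, ‖c i‖ < 1) (hlam : ‖c lam‖ = 1) :
    ∃ n₀ : ℕ, ∀ n : ℕ, n₀ ≤ n → ∀ ζ : K, IsPrimitiveRoot ζ (p ^ n) →
      Summable (fun i : ℕ => c i * (ζ - 1) ^ i) ∧
      -Real.log ‖∑' i : ℕ, c i * (ζ - 1) ^ i‖ / Real.log p =
        (lam : ℝ) * (-Real.log ‖ζ - 1‖ / Real.log p) ∧
      -Real.log ‖∑' i : ℕ, c i * (ζ - 1) ^ i‖ / Real.log p =
        (lam : ℝ) / ((p : ℝ) ^ (n - 1) * ((p : ℝ) - 1)) := by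
  have hp : p.Prime := Fact.out
  have hp1 : (1 : ℝ) < p := by exact_mod_cast hp.one_lt
  have hlogp : 0 < Real.log p := Real.log_pos hp1
  have hnp : ‖(p : K)‖ = (p : ℝ)⁻¹ := by
    rw [← map_natCast (algebraMap ℚ_[p] K), hnorm, Padic.norm_p]
  obtain ⟨M, hM0, hM1, hM⟩ := exists_forall_lt_norm_le hlt
  obtain ⟨n₁, hn₁⟩ := exists_pow_lt_of_lt_one
    (show (0 : ℝ) < (p : ℝ)⁻¹ ^ lam by positivity) hM1
  refine ⟨n₁ + 1, fun n hn ζ hζ => ?_⟩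
  obtain ⟨k, rfl⟩ : ∃ k, n = k + 1 := ⟨n - 1, by omega⟩
  have hr := hζ.norm_sub_one_pow_eq
  rw [hnp] at hr
  set N := p ^ k * (p - 1) with hN
  have hkN : k < N := (Nat.lt_pow_self hp.one_lt).trans_le
    (Nat.le_mul_of_pos_right _ (Nat.sub_pos_of_lt hp.one_lt))
  have hN0 : N ≠ 0 := by omega
  have hr1 : ‖ζ - 1‖ < 1 := by
    refine lt_of_pow_lt_pow_left₀ N zero_le_one ?_
    rw [hr, one_pow]
    exact inv_lt_one_of_one_lt₀ hp1
  have hx0 : ζ - 1 ≠ 0 := by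
    intro h0
    rw [h0, norm_zero, zero_pow hN0] at hr
    exact (inv_pos.mpr (zero_lt_one.trans hp1)).ne hr
  have hMr : M < ‖ζ - 1‖ ^ lam := by
    refine lt_of_pow_lt_pow_left₀ N (by positivity) ?_
    rw [pow_right_comm, hr]
    exact (pow_le_pow_of_le_one hM0 hM1.le (by omega)).trans_lt hn₁
  have hlog : (N : ℝ) * Real.log ‖ζ - 1‖ = -Real.log p := by
    rw [← Real.log_pow, hr, Real.log_inv]
  have hNcast : (N : ℝ) = (p : ℝ) ^ k * ((p : ℝ) - 1) := by
    rw [hN, Nat.cast_mul, Nat.cast_pow, Nat.cast_sub hp.one_lt.le, Nat.cast_one]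
  have hNpos : (N : ℝ) ≠ 0 := Nat.cast_ne_zero.mpr hN0
  rw [norm_tsum_mul_pow_eq hc hlam hx0 hr1 hM hMr, Real.log_pow, Nat.add_sub_cancel, ← hNcast]
  refine ⟨summable_mul_pow_of_norm_lt_one hc hr1, by ring, ?_⟩
  rw [div_eq_div_iff hlogp.ne' hNpos]
  linear_combination (-(lam : ℝ)) * hlog
end

section
/- Let p be an odd prime, (c_i)_{i≥0} a sequence in ℂ_p with ‖c_i‖ ≤ 1 for all i, and λ ∈ ℕ with ‖c_i‖ < 1 for i < λ and ‖c_λ‖ = 1. Let π ∈ ℂ_p be nonzero with ord_p(π) = m ∈ ℚ, and set f(x) = π · ∑_{i=0}^∞ c_i x^i. Then there exist n_0 ∈ ℕ and a constant c ∈ ℚ such that for all n ≥ n_0, ∑_{t=n_0}^{n} ∑_{ζ} ord_p( f(ζ − 1) ) = m·p^n + λ·n + c, where the inner sum runs over all primitive p^t-th roots of unity ζ in ℂ_p. -/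
open Finset

/-- A power series over a complete ultrametric field whose term of index `k` at `x` dominates all
others has the norm of that term. -/
lemma norm_tsum_eq_pow_of_dominant {K : Type*} [NontriviallyNormedField K] [CompleteSpace K]
    [IsUltrametricDist K] {c : ℕ → K} (hc : ∀ i, ‖c i‖ ≤ 1) {k : ℕ} (hk : ‖c k‖ = 1)
    {x : K} (hx0 : x ≠ 0) (hx1 : ‖x‖ < 1) {a : ℝ} (ha : ∀ i < k, ‖c i‖ ≤ a)
    (hak : a < ‖x‖ ^ k) :
    ‖∑' i : ℕ, c i * x ^ i‖ = ‖x‖ ^ k := by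
  have hx : 0 < ‖x‖ := norm_pos_iff.2 hx0
  have hsum : Summable fun i : ℕ => c i * x ^ i := by
    refine Summable.of_norm_bounded (summable_geometric_of_lt_one (norm_nonneg x) hx1) fun i => ?_
    rw [norm_mul, norm_pow]
    exact mul_le_of_le_one_left (by positivity) (hc i)
  have hterm : ‖c k * x ^ k‖ = ‖x‖ ^ k := by rw [norm_mul, norm_pow, hk, one_mul]
  have htail : ‖∑' i, ite (i = k) 0 (c i * x ^ i)‖ < ‖c k * x ^ k‖ := by
    rw [hterm]
    refine lt_of_le_of_lt (b := max a (‖x‖ ^ (k + 1))) ?_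
      (max_lt hak (pow_lt_pow_right_of_lt_one₀ hx hx1 k.lt_succ_self))
    have hB : 0 ≤ max a (‖x‖ ^ (k + 1)) := le_max_of_le_right (by positivity)
    refine IsUltrametricDist.norm_tsum_le_of_forall_le_of_nonneg hB fun i => ?_
    split_ifs with h
    · simp
    · rw [norm_mul, norm_pow]
      rcases lt_or_gt_of_ne h with h | h
      · exact le_max_of_le_left ((mul_le_of_le_one_right (norm_nonneg _)
          (pow_le_one₀ hx.le hx1.le)).trans (ha i h))
      · exact le_max_of_le_right ((mul_le_of_le_one_left (by positivity) (hc i)).trans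
          (pow_le_pow_of_le_one hx.le hx1.le h))
  rw [hsum.tsum_eq_add_tsum_ite k,
    IsUltrametricDist.norm_add_eq_max_of_norm_ne_norm htail.ne', max_eq_left htail.le, hterm]

lemma IsPrimitiveRoot.norm_sub_one_le {K : Type*} [NormedField K] [IsUltrametricDist K]
    {n : ℕ} [NeZero n] {ζ μ : K} (hζ : IsPrimitiveRoot ζ n) (hμ : IsPrimitiveRoot μ n) :
    ‖μ - 1‖ ≤ ‖ζ - 1‖ := by
  obtain ⟨i, -, rfl⟩ := hζ.eq_pow_of_pow_eq_one hμ.pow_eq_one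
  rw [← mul_geom_sum, norm_mul]
  refine mul_le_of_le_one_right (norm_nonneg _) ?_
  refine IsUltrametricDist.norm_sum_le_of_forall_le_of_nonneg zero_le_one fun j _ => ?_
  rw [norm_pow, (pow_eq_one_iff_of_nonneg (norm_nonneg ζ) (NeZero.ne n)).1
    (by rw [← norm_pow, hζ.pow_eq_one, norm_one]), one_pow]

lemma prod_norm_primitiveRoots_sub_one {p : ℕ} [Fact p.Prime] {K : Type*} [NormedField K]
    [IsAlgClosed K] [CharZero K] (t : ℕ) :
    ∏ ζ ∈ primitiveRoots (p ^ (t + 1)) K, ‖ζ - 1‖ = ‖(p : K)‖ := by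
  have hp : p ≠ 0 := (Fact.out : p.Prime).ne_zero
  have : NeZero ((p ^ (t + 1) : ℕ) : K) := ⟨by exact_mod_cast pow_ne_zero _ hp⟩
  obtain ⟨ζ, hζ⟩ := HasEnoughRootsOfUnity.exists_primitiveRoot K (p ^ (t + 1))
  have h := Polynomial.eval_one_cyclotomic_prime_pow (R := K) (p := p) t
  rw [Polynomial.cyclotomic_eq_prod_X_sub_primitiveRoots hζ, Polynomial.eval_prod] at h
  rw [← h, norm_prod]
  refine prod_congr rfl fun μ _ => ?_
  simp [norm_sub_rev]

lemma norm_sub_one_pow_totient {p : ℕ} [Fact p.Prime] {K : Type*} [NormedField K]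
    [IsAlgClosed K] [CharZero K] [IsUltrametricDist K] {t : ℕ} {ζ : K}
    (hζ : IsPrimitiveRoot ζ (p ^ (t + 1))) :
    ‖ζ - 1‖ ^ (p ^ (t + 1)).totient = ‖(p : K)‖ := by
  have : NeZero (p ^ (t + 1)) := ⟨pow_ne_zero _ (Fact.out : p.Prime).ne_zero⟩
  rw [← prod_norm_primitiveRoots_sub_one t, ← hζ.card_primitiveRoots, ← prod_const]
  refine prod_congr rfl fun μ hμ => ?_
  have hμ := isPrimitiveRoot_of_mem_primitiveRoots hμ
  exact le_antisymm (hμ.norm_sub_one_le hζ) (hζ.norm_sub_one_le hμ)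

lemma lt_totient_prime_pow {p : ℕ} (hp : p.Prime) (t : ℕ) :
    t < (p ^ (t + 1)).totient := by
  rw [Nat.totient_prime_pow_succ hp]
  exact (Nat.lt_pow_self hp.one_lt).trans_le
    (Nat.le_mul_of_pos_right _ (Nat.sub_pos_of_lt hp.one_lt))

/-- The sum of the valuations of `π * ∑ c i (ζ - 1) ^ i` over the primitive `p ^ (t + 1)`-th roots
of unity, when `t` is so large that the term of index `k` dominates. -/
lemma sum_ord_primitiveRoots {p : ℕ} [Fact p.Prime] {K : Type*} [NontriviallyNormedField K]
    [IsAlgClosed K] [CharZero K] [CompleteSpace K] [IsUltrametricDist K]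
    (hpK : ‖(p : K)‖ = (p : ℝ)⁻¹) {c : ℕ → K} (hc : ∀ i, ‖c i‖ ≤ 1) {k : ℕ} (hk : ‖c k‖ = 1)
    {π : K} (hπ : π ≠ 0) {a : ℝ} (ha : ∀ i < k, ‖c i‖ ≤ a) {t : ℕ}
    (hat : a ^ (p ^ (t + 1)).totient < (p : ℝ)⁻¹ ^ k) :
    ∑ ζ ∈ primitiveRoots (p ^ (t + 1)) K,
        (-Real.log ‖π * ∑' i : ℕ, c i * (ζ - 1) ^ i‖ / Real.log p) =
      (p ^ (t + 1)).totient * (-Real.log ‖π‖ / Real.log p) + k := by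
  have hp : p.Prime := Fact.out
  have hp1 : (1 : ℝ) < p := by exact_mod_cast hp.one_lt
  have hlog : Real.log p ≠ 0 := (Real.log_pos hp1).ne'
  have : NeZero ((p ^ (t + 1) : ℕ) : K) := ⟨by exact_mod_cast pow_ne_zero _ hp.ne_zero⟩
  have hne : ∀ ζ ∈ primitiveRoots (p ^ (t + 1)) K, ζ - 1 ≠ 0 := fun ζ hζ =>
    sub_ne_zero.2 ((isPrimitiveRoot_of_mem_primitiveRoots hζ).ne_one
      (Nat.one_lt_pow t.succ_ne_zero hp.one_lt))
  have hterm : ∀ ζ ∈ primitiveRoots (p ^ (t + 1)) K,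
      -Real.log ‖π * ∑' i : ℕ, c i * (ζ - 1) ^ i‖ / Real.log p =
        -Real.log ‖π‖ / Real.log p - k / Real.log p * Real.log ‖ζ - 1‖ := by
    intro ζ hζ
    have hr := norm_sub_one_pow_totient (isPrimitiveRoot_of_mem_primitiveRoots hζ)
    rw [hpK] at hr
    have hx1 : ‖ζ - 1‖ < 1 := by
      refine lt_of_pow_lt_pow_left₀ (p ^ (t + 1)).totient zero_le_one ?_
      rw [hr, one_pow]
      exact inv_lt_one_of_one_lt₀ hp1
    have hak : a < ‖ζ - 1‖ ^ k := by
      refine lt_of_pow_lt_pow_left₀ (p ^ (t + 1)).totient (by positivity) ?_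
      rwa [pow_right_comm, hr]
    have hx0 := norm_pos_iff.2 (hne ζ hζ)
    rw [norm_mul, norm_tsum_eq_pow_of_dominant hc hk (hne ζ hζ) hx1 ha hak,
      Real.log_mul (norm_ne_zero_iff.2 hπ) (by positivity), Real.log_pow]
    ring
  obtain ⟨ζ, hζ⟩ := HasEnoughRootsOfUnity.exists_primitiveRoot K (p ^ (t + 1))
  rw [sum_congr rfl hterm, sum_sub_distrib, sum_const, hζ.card_primitiveRoots, nsmul_eq_mul,
    ← mul_sum, ← Real.log_prod fun ζ hζ => norm_ne_zero_iff.2 (hne ζ hζ),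
    prod_norm_primitiveRoots_sub_one, hpK, Real.log_inv]
  field_simp
  ring

/-- Let `p` be an odd prime and work in `ℂ_p`, modelled as a
complete, algebraically closed, nonarchimedean normed field `K` whose norm
extends the `p`-adic norm of `ℚ_p`; write `ord_p x = −log‖x‖/log p`. Let
`(c_i)` be a sequence in `K` with `‖c_i‖ ≤ 1`, `λ ∈ ℕ` with `‖c_i‖ < 1` for
`i < λ` and `‖c_λ‖ = 1`, and `π ∈ K` nonzero with `ord_p π = m ∈ ℚ`. Set
`f(x) = π ∑_{i=0}^∞ c_i x^i`. Then there exist `n₀ ∈ ℕ` and `c ∈ ℚ` such that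
for all `n ≥ n₀`,
`∑_{t=n₀}^n ∑_ζ ord_p f(ζ − 1) = m·p^n + λ·n + c`, the inner sum being over
the primitive `p^t`-th roots of unity `ζ` in `K`. -/
theorem statement13 (p : ℕ) [Fact p.Prime] (hp2 : p ≠ 2)
    (K : Type*) [NontriviallyNormedField K] [IsAlgClosed K] [CompleteSpace K]
    [IsUltrametricDist K] [Algebra ℚ_[p] K]
    (hnorm : ∀ x : ℚ_[p], ‖algebraMap ℚ_[p] K x‖ = ‖x‖)
    (c : ℕ → K) (hc : ∀ i, ‖c i‖ ≤ 1)
    (lam : ℕ) (hlt : ∀ i < lam, ‖c i‖ < 1) (hlam : ‖c lam‖ = 1)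
    (π : K) (hπ : π ≠ 0) (m : ℚ) (hm : -Real.log ‖π‖ / Real.log p = (m : ℝ)) :
    ∃ (n₀ : ℕ) (C : ℚ), ∀ n : ℕ, n₀ ≤ n →
      ∑ t ∈ Finset.Icc n₀ n, ∑ ζ ∈ primitiveRoots (p ^ t) K,
          (-Real.log ‖π * ∑' i : ℕ, c i * (ζ - 1) ^ i‖ / Real.log p) =
        (m : ℝ) * (p : ℝ) ^ n + (lam : ℝ) * n + (C : ℝ) := by
  have hp : p.Prime := Fact.out
  have hp1 : (1 : ℝ) < p := by exact_mod_cast hp.one_lt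
  have : CharZero K := (RingHom.charZero_iff (algebraMap ℚ_[p] K).injective).mp inferInstance
  have hpK : ‖(p : K)‖ = (p : ℝ)⁻¹ := by
    rw [← map_natCast (algebraMap ℚ_[p] K), hnorm, Padic.norm_p]
  obtain ⟨a, ha0, ha1, ha⟩ : ∃ a : ℝ, 0 ≤ a ∧ a < 1 ∧ ∀ i < lam, ‖c i‖ ≤ a := by
    refine ⟨((range lam).sup fun i => ‖c i‖₊ : NNReal), NNReal.coe_nonneg _, ?_, fun i hi => ?_⟩
    · exact_mod_cast (Finset.sup_lt_iff (by simp)).2 fun i hi =>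
        (by exact_mod_cast hlt i (mem_range.1 hi) : ‖c i‖₊ < 1)
    · exact_mod_cast le_sup (f := fun i => ‖c i‖₊) (mem_range.2 hi)
  obtain ⟨N, hN⟩ := Filter.eventually_atTop.1
    ((tendsto_pow_atTop_nhds_zero_of_lt_one ha0 ha1).eventually_lt_const
      (by positivity : (0 : ℝ) < (p : ℝ)⁻¹ ^ lam))
  refine ⟨N + 1, -m * p ^ N - lam * N, fun n hn => ?_⟩
  have hlayer : ∀ t, N ≤ t → ∑ ζ ∈ primitiveRoots (p ^ (t + 1)) K,
      (-Real.log ‖π * ∑' i : ℕ, c i * (ζ - 1) ^ i‖ / Real.log p) =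
        (p ^ (t + 1) - p ^ t : ℝ) * m + lam := by
    intro t ht
    rw [sum_ord_primitiveRoots hpK hc hlam hπ ha
      (hN _ (ht.trans (lt_totient_prime_pow hp t).le)), hm, Nat.totient_prime_pow_succ hp]
    push_cast [hp.one_le]
    ring
  induction n, hn using Nat.le_induction with
  | base =>
    rw [Icc_self, sum_singleton, hlayer N le_rfl]
    push_cast
    ring
  | succ n hn ih =>
    rw [sum_Icc_succ_top (by lia), ih, hlayer n (by lia)]
    push_cast
    ring
end
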